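/- Fix c > 0 and η ∈ [0,1) with c < c̄(η), let ζ = ζ(c,η), and let λ : ℕ → (0,∞) be any sequence with √n·λ(n) → c. Then lim_{n→∞} n^{-3/2}·log Z(λ(n), ζ) = ( W(2ζc²)^{3/2} + 3·W(2ζc²)^{1/2} ) / (6·√(2ζ)). -/

import Mathlib

open Filter
open scoped BigOperators symmDiff Classical

noncomputable section

/-- Number of edges of a labeled simple graph on `Fin n`. -/
def edgeCount {n : ℕ} (G : SimpleGraph (Fin n)) : ℕ := Nat.card G.edgeSet

/-- Number of triangles of a labeled simple graph on `Fin n`. -/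
def triCount {n : ℕ} (G : SimpleGraph (Fin n)) : ℕ :=
  Nat.card {s : Finset (Fin n) // G.IsNClique 3 s}

/-- Probability of the event `A` under the Erdős–Rényi random graph `G(n,p)`. -/
def erProb (n : ℕ) (p : ℝ) (A : Set (SimpleGraph (Fin n))) : ℝ :=
  ∑ G : SimpleGraph (Fin n),
    if G ∈ A then p ^ edgeCount G * (1 - p) ^ (n.choose 2 - edgeCount G) else 0

/-- Conditional probability `P_p(A | B)` for `G(n,p)`. -/
def erCondProb (n : ℕ) (p : ℝ) (A B : Set (SimpleGraph (Fin n))) : ℝ :=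
  erProb n p (A ∩ B) / erProb n p B

/-- Probability of the event `A` under the uniform random graph `G(n,m)`. -/
def gnmProb (n m : ℕ) (A : Set (SimpleGraph (Fin n))) : ℝ :=
  (Nat.card {G : SimpleGraph (Fin n) // edgeCount G = m ∧ G ∈ A} : ℝ) /
    ((n.choose 2).choose m : ℝ)

/-- Expected number of triangles of `G(n,m)`. -/
def gnmExpTri (n m : ℕ) : ℝ :=
  (∑ G : SimpleGraph (Fin n), if edgeCount G = m then (triCount G : ℝ) else 0) /
    ((n.choose 2).choose m : ℝ)

/-- Gibbs weight `λ^{|G|} (1-ζ)^{X(G)}`. -/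
def gibbsWeight {n : ℕ} (lam zeta : ℝ) (G : SimpleGraph (Fin n)) : ℝ :=
  lam ^ edgeCount G * (1 - zeta) ^ triCount G

/-- The partition function `Z(λ,ζ)`. -/
def Zfun (n : ℕ) (lam zeta : ℝ) : ℝ := ∑ G : SimpleGraph (Fin n), gibbsWeight lam zeta G

/-- Probability of the event `A` under the Gibbs measure `μ_{λ,ζ}`. -/
def gibbsProb (n : ℕ) (lam zeta : ℝ) (A : Set (SimpleGraph (Fin n))) : ℝ :=
  (∑ G : SimpleGraph (Fin n), if G ∈ A then gibbsWeight lam zeta G else 0) / Zfun n lam zeta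

/-- Expectation of `f` under the Gibbs measure `μ_{λ,ζ}`. -/
def gibbsExp (n : ℕ) (lam zeta : ℝ) (f : SimpleGraph (Fin n) → ℝ) : ℝ :=
  (∑ G : SimpleGraph (Fin n), f G * gibbsWeight lam zeta G) / Zfun n lam zeta

/-- Number of edges of `H` with both endpoints in `S`. -/
def edgesIn {V : Type*} (H : SimpleGraph V) (S : Finset V) : ℕ :=
  Nat.card {e : Sym2 V // e ∈ H.edgeSet ∧ ∀ v ∈ e, v ∈ S}

/-- Weight `λ^{|S|} (1-ζ)^{|E(S)|}` of the measure `ν_{H,λ,ζ}`. -/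
def nuWeight {V : Type*} (H : SimpleGraph V) (lam zeta : ℝ) (S : Finset V) : ℝ :=
  lam ^ S.card * (1 - zeta) ^ edgesIn H S

/-- The partition function `Ξ_H(λ,ζ)`. -/
def XiFun {V : Type*} [Fintype V] (H : SimpleGraph V) (lam zeta : ℝ) : ℝ :=
  ∑ S : Finset V, nuWeight H lam zeta S

/-- The probability of `S` under `ν_{H,λ,ζ}`. -/
def nuProb {V : Type*} [Fintype V] (H : SimpleGraph V) (lam zeta : ℝ) (S : Finset V) : ℝ :=
  nuWeight H lam zeta S / XiFun H lam zeta

/-- `W` is the Lambert-W function on `[0,∞)`: for `x ≥ 0`, `W x` is the unique `w ≥ 0`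
with `w·e^w = x`. -/
def IsLambertW (W : ℝ → ℝ) : Prop :=
  ∀ x : ℝ, 0 ≤ x → (0 ≤ W x ∧ W x * Real.exp (W x) = x ∧
    ∀ w : ℝ, 0 ≤ w → w * Real.exp w = x → w = W x)

/-- `η* = (W(2/e)/(2/e))^{3/2}`. -/
def etaStar (W : ℝ → ℝ) : ℝ := (W (2 / Real.exp 1) / (2 / Real.exp 1)) ^ ((3 : ℝ) / 2)

/-- The condition `c < c̄(η)` where `c̄(η) = 1/√(e(1−η/η*))` for `η < η*` and `+∞` otherwise. -/
def LtCbar (W : ℝ → ℝ) (c η : ℝ) : Prop :=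
  η < etaStar W → c < 1 / Real.sqrt (Real.exp 1 * (1 - η / etaStar W))

/-- The left-hand side of the equation defining `ζ(c,η)`, interpreted as `1` at `ζ = 0`. -/
def zetaLHS (W : ℝ → ℝ) (c zeta : ℝ) : ℝ :=
  (1 - zeta) * (if zeta = 0 then 1 else
    (W (2 * zeta * c ^ 2) / (2 * zeta * c ^ 2)) ^ ((3 : ℝ) / 2))




namespace Hyper

/-! ### Partition functions of weighted hypergraphs -/

section General

set_option linter.unusedSectionVars false

variable {V : Type*} [DecidableEq V]

/-- The weight of a vertex set: the product of the weights of all hyperedges it contains. -/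
def weight (φ : Finset V → ℝ) (S : Finset V) : ℝ := ∏ h ∈ S.powerset, φ h

/-- The total weight of the subsets of `U`. -/
def partition (φ : Finset V → ℝ) (U : Finset V) : ℝ := ∑ S ∈ U.powerset, weight φ S

/-- The total weight of the subsets of `U` which contain `h`. -/
def mass (φ : Finset V → ℝ) (U h : Finset V) : ℝ :=
  ∑ S ∈ U.powerset, if h ⊆ S then weight φ S else 0

/-- The probability that a random subset of `U` contains `h`. -/
def prob (φ : Finset V → ℝ) (U h : Finset V) : ℝ := mass φ U h / partition φ U

/-- Multiply the weight of each nonempty `h ∈ A` avoiding `v` by the weight of `insert v h`. -/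
def twist (φ : Finset V → ℝ) (v : V) (A : Finset (Finset V)) (h : Finset V) : ℝ :=
  φ h * if h ∈ A ∧ h ≠ ∅ ∧ v ∉ h then φ (insert v h) else 1

variable {φ ψ : Finset V → ℝ} {U S h : Finset V} {v x y : V}

lemma mass_empty (φ : Finset V → ℝ) (U : Finset V) : mass φ U ∅ = partition φ U := by
  simp [mass, partition]

lemma twist_empty (φ : Finset V → ℝ) (v : V) : twist φ v ∅ = φ := by
  ext h; simp [twist]

lemma weight_empty (h0 : φ ∅ = 1) : weight φ ∅ = 1 := by simp [weight, h0]

lemma weight_nonneg (h0 : ∀ h, 0 ≤ φ h) (S : Finset V) : 0 ≤ weight φ S :=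
  Finset.prod_nonneg fun h _ => h0 h

lemma one_le_partition (h0 : ∀ h, 0 ≤ φ h) (h1 : φ ∅ = 1) (U : Finset V) :
    1 ≤ partition φ U := by
  rw [← weight_empty h1]
  exact Finset.single_le_sum (f := weight φ) (fun S _ => weight_nonneg h0 S)
    (Finset.empty_mem_powerset U)

lemma partition_mono (h0 : ∀ h, 0 ≤ φ h) (h1 : ∀ h, φ h ≤ ψ h) (U : Finset V) :
    partition φ U ≤ partition ψ U :=
  Finset.sum_le_sum fun _ _ => Finset.prod_le_prod (fun h _ => h0 h) fun h _ => h1 h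

lemma mass_nonneg (h0 : ∀ h, 0 ≤ φ h) (U h : Finset V) : 0 ≤ mass φ U h :=
  Finset.sum_nonneg fun _ _ => by split_ifs; exacts [weight_nonneg h0 _, le_rfl]

lemma mass_anti (h0 : ∀ h, 0 ≤ φ h) {g : Finset V} (hg : g ⊆ h) : mass φ U h ≤ mass φ U g := by
  refine Finset.sum_le_sum fun S _ => ?_
  by_cases hS : h ⊆ S
  · simp [hS, hg.trans hS]
  · rw [if_neg hS]; split_ifs; exacts [weight_nonneg h0 _, le_rfl]

lemma mass_of_not_subset (hU : ¬ h ⊆ U) : mass φ U h = 0 :=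
  Finset.sum_eq_zero fun _ hS => if_neg fun hh => hU (hh.trans (Finset.mem_powerset.1 hS))

lemma prob_nonneg (h0 : ∀ h, 0 ≤ φ h) (h1 : φ ∅ = 1) (U h : Finset V) : 0 ≤ prob φ U h :=
  div_nonneg (mass_nonneg h0 U h) (zero_le_one.trans (one_le_partition h0 h1 U))

lemma prob_anti (h0 : ∀ h, 0 ≤ φ h) (h1 : φ ∅ = 1) {g : Finset V} (hg : g ⊆ h) :
    prob φ U h ≤ prob φ U g :=
  div_le_div_of_nonneg_right (mass_anti h0 hg) (zero_le_one.trans (one_le_partition h0 h1 U))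

lemma partition_eq_add_mass (hv : v ∈ U) :
    partition φ U = partition φ (U.erase v) + mass φ U {v} := by
  obtain ⟨U, hvU, rfl⟩ : ∃ U' : Finset V, v ∉ U' ∧ insert v U' = U :=
    ⟨U.erase v, Finset.notMem_erase v U, Finset.insert_erase hv⟩
  unfold partition mass
  have hnot : ∀ S ∈ U.powerset, v ∉ S := fun S hS hvS => hvU (Finset.mem_powerset.1 hS hvS)
  rw [Finset.sum_powerset_insert hvU, Finset.sum_powerset_insert hvU, Finset.erase_insert hvU]
  have hzero : ∑ S ∈ U.powerset, (if {v} ⊆ S then weight φ S else 0) = 0 :=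
    Finset.sum_eq_zero fun S hS => if_neg fun hh => hnot S hS (hh (Finset.mem_singleton_self v))
  rw [hzero]
  simp

variable [Fintype V]

lemma weight_insert (hv : v ∉ S) :
    weight φ (insert v S) = φ {v} * weight (twist φ v Finset.univ) S := by
  unfold weight twist
  rw [Finset.prod_powerset_insert hv, Finset.prod_mul_distrib, mul_left_comm]
  congr 1
  have hempty := Finset.empty_mem_powerset S
  rw [← Finset.mul_prod_erase _ _ hempty, insert_empty_eq]
  congr 1
  rw [← Finset.prod_erase (a := ∅) S.powerset (by simp)]
  refine Finset.prod_congr rfl fun h hh => ?_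
  rw [Finset.mem_erase, Finset.mem_powerset] at hh
  rw [if_pos ⟨Finset.mem_univ _, hh.1, fun hvh => hv (hh.2 hvh)⟩]

lemma mass_insert (hv : v ∈ U) (hvh : v ∉ h) :
    mass φ U (insert v h) = φ {v} * mass (twist φ v Finset.univ) (U.erase v) h := by
  conv_lhs => rw [← Finset.insert_erase hv]
  unfold mass
  rw [Finset.sum_powerset_insert (Finset.notMem_erase v U), Finset.mul_sum]
  have hnot : ∀ S ∈ (U.erase v).powerset, v ∉ S := fun S hS hvS =>
    Finset.notMem_erase v U (Finset.mem_powerset.1 hS hvS)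
  rw [Finset.sum_eq_zero, zero_add]
  · refine Finset.sum_congr rfl fun S hS => ?_
    have : insert v h ⊆ insert v S ↔ h ⊆ S := Finset.insert_subset_insert_iff hvh
    simp only [this, mul_ite, mul_zero, weight_insert (hnot S hS)]
  · intro S hS
    exact if_neg fun hh => hnot S hS (hh (Finset.mem_insert_self v h))

lemma mass_singleton (hv : v ∈ U) :
    mass φ U {v} = φ {v} * partition (twist φ v Finset.univ) (U.erase v) := by
  rw [← mass_empty, ← mass_insert hv (Finset.notMem_empty v), insert_empty_eq]

lemma twist_nonneg (h0 : ∀ h, 0 ≤ φ h) (v : V) (A : Finset (Finset V)) (h : Finset V) :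
    0 ≤ twist φ v A h :=
  mul_nonneg (h0 h) (by split_ifs; exacts [h0 _, zero_le_one])

lemma twist_le (h0 : ∀ h, 0 ≤ φ h) (h1 : ∀ h, φ h ≤ 1) (v : V) (A : Finset (Finset V))
    (h : Finset V) : twist φ v A h ≤ φ h :=
  mul_le_of_le_one_right (h0 h) (by split_ifs; exacts [h1 _, le_rfl])

lemma twist_apply_empty (φ : Finset V → ℝ) (v : V) (A : Finset (Finset V)) :
    twist φ v A ∅ = φ ∅ := by simp [twist]

/-- The factor by which `twist` changes the weight of `h` when `h` is added to `A`. -/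
def factor (φ : Finset V → ℝ) (v : V) (h : Finset V) : ℝ :=
  if h ≠ ∅ ∧ v ∉ h then φ (insert v h) else 1

lemma factor_nonneg (h0 : ∀ h, 0 ≤ φ h) (v : V) (h : Finset V) : 0 ≤ factor φ v h := by
  unfold factor; split_ifs; exacts [h0 _, zero_le_one]

lemma factor_le_one (h1 : ∀ h, φ h ≤ 1) (v : V) (h : Finset V) : factor φ v h ≤ 1 := by
  unfold factor; split_ifs; exacts [h1 _, le_rfl]

lemma weight_twist_insert {A : Finset (Finset V)} (hA : h ∉ A) (S : Finset V) :
    weight (twist φ v (insert h A)) S =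
      weight (twist φ v A) S * if h ⊆ S then factor φ v h else 1 := by
  have key : ∀ g, twist φ v (insert h A) g =
      twist φ v A g * if g = h then factor φ v h else 1 := by
    intro g
    by_cases hg : g = h
    · subst hg; simp [twist, factor, hA]
    · simp [twist, hg]
  unfold weight
  simp_rw [key]
  rw [Finset.prod_mul_distrib, Finset.prod_ite_eq']
  simp

lemma partition_twist_insert {A : Finset (Finset V)} (hA : h ∉ A) (U : Finset V) :
    partition (twist φ v (insert h A)) U =
      partition (twist φ v A) U - (1 - factor φ v h) * mass (twist φ v A) U h := by
  unfold partition mass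
  rw [Finset.mul_sum, ← Finset.sum_sub_distrib]
  refine Finset.sum_congr rfl fun S _ => ?_
  rw [weight_twist_insert hA]
  split_ifs <;> ring

/-- Adding the hyperedges of `A` one at a time bounds the partition function of the twist. -/
lemma prod_le_partition_twist (h0 : ∀ h, 0 ≤ φ h) (he : φ ∅ = 1) (lo hi : Finset V → ℝ)
    (hlo0 : ∀ h, 0 ≤ lo h)
    (hlo : ∀ A h, h ∉ A → lo h ≤ 1 - (1 - factor φ v h) * prob (twist φ v A) U h)
    (hhi : ∀ A h, h ∉ A → 1 - (1 - factor φ v h) * prob (twist φ v A) U h ≤ hi h)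
    (A : Finset (Finset V)) :
    (∏ h ∈ A, lo h) * partition φ U ≤ partition (twist φ v A) U ∧
      partition (twist φ v A) U ≤ (∏ h ∈ A, hi h) * partition φ U := by
  induction A using Finset.induction_on with
  | empty => simp [twist_empty]
  | insert h A hA ih =>
    have hpos : 0 < partition (twist φ v A) U := zero_lt_one.trans_le
      (one_le_partition (twist_nonneg h0 v A) (by rw [twist_apply_empty, he]) U)
    have hstep : partition (twist φ v (insert h A)) U =
        (1 - (1 - factor φ v h) * prob (twist φ v A) U h) * partition (twist φ v A) U := by
      rw [partition_twist_insert hA, prob]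
      field_simp
    have h1 := hlo A h hA
    have h2 := hhi A h hA
    rw [Finset.prod_insert hA, Finset.prod_insert hA, hstep, mul_assoc, mul_assoc]
    exact ⟨mul_le_mul h1 ih.1 (mul_nonneg (Finset.prod_nonneg fun g _ => hlo0 g)
        (zero_le_one.trans (one_le_partition h0 he U))) ((hlo0 h).trans h1),
      mul_le_mul h2 ih.2 hpos.le ((hlo0 h).trans (h1.trans h2))⟩

/-- The ratio of the partition functions given that `v` is present and absent. -/
def ratio (φ : Finset V → ℝ) (U : Finset V) (v : V) : ℝ :=
  partition (twist φ v Finset.univ) (U.erase v) / partition φ (U.erase v)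

lemma prob_singleton (h0 : ∀ h, 0 ≤ φ h) (he : φ ∅ = 1) (hv : v ∈ U) :
    prob φ U {v} = φ {v} * ratio φ U v / (1 + φ {v} * ratio φ U v) := by
  have hpos : 0 < partition φ (U.erase v) :=
    zero_lt_one.trans_le (one_le_partition h0 he _)
  have hpos' : 0 ≤ partition (twist φ v Finset.univ) (U.erase v) :=
    zero_le_one.trans (one_le_partition (twist_nonneg h0 v _) (by rw [twist_apply_empty, he]) _)
  have := mul_nonneg (h0 {v}) hpos'
  rw [prob, partition_eq_add_mass hv, mass_singleton hv, ratio]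
  field_simp

lemma ratio_nonneg (h0 : ∀ h, 0 ≤ φ h) (he : φ ∅ = 1) : 0 ≤ ratio φ U v :=
  div_nonneg
    (zero_le_one.trans (one_le_partition (twist_nonneg h0 v _) (by rw [twist_apply_empty, he]) _))
    (zero_le_one.trans (one_le_partition h0 he _))

lemma ratio_le_one (h0 : ∀ h, 0 ≤ φ h) (h1 : ∀ h, φ h ≤ 1) (he : φ ∅ = 1) : ratio φ U v ≤ 1 :=
  div_le_one_of_le₀ (partition_mono (twist_nonneg h0 v _) (twist_le h0 h1 v _) _)
    (zero_le_one.trans (one_le_partition h0 he _))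

lemma prob_singleton_le (h0 : ∀ h, 0 ≤ φ h) (h1 : ∀ h, φ h ≤ 1) (he : φ ∅ = 1) (hv : v ∈ U) :
    prob φ U {v} ≤ φ {v} := by
  have hr := ratio_nonneg (U := U) (v := v) h0 he
  rw [prob_singleton h0 he hv]
  exact (div_le_self (mul_nonneg (h0 _) hr) (by linarith [mul_nonneg (h0 {v}) hr])).trans
    (mul_le_of_le_one_right (h0 _) (ratio_le_one h0 h1 he))

lemma prob_insert (h0 : ∀ h, 0 ≤ φ h) (he : φ ∅ = 1) (hv : v ∈ U) (hvh : v ∉ h) :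
    prob φ U (insert v h) =
      prob φ U {v} * prob (twist φ v Finset.univ) (U.erase v) h := by
  have hpos : 0 < partition φ U := zero_lt_one.trans_le (one_le_partition h0 he _)
  have hpos' : 0 < partition (twist φ v Finset.univ) (U.erase v) := zero_lt_one.trans_le
    (one_le_partition (twist_nonneg h0 v _) (by rw [twist_apply_empty, he]) _)
  rw [prob, prob, prob, mass_insert hv hvh, mass_singleton hv]
  field_simp

end General

/-! ### Linear triple systems -/

section Triples

set_option linter.unusedSectionVars false

variable {V : Type*} [DecidableEq V]

/-- `T` is a system of triples in `U₀`, any two of which share at most one vertex, such that each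
vertex of `U₀` lies in exactly `N` triples. -/
structure IsLinearSystem (U₀ : Finset V) (T : Finset (Finset V)) (N : ℕ) : Prop where
  card_eq : ∀ h ∈ T, h.card = 3
  subset : ∀ h ∈ T, h ⊆ U₀
  linear : ∀ h ∈ T, ∀ g ∈ T, ∀ v x, v ≠ x → v ∈ h → x ∈ h → v ∈ g → x ∈ g → h = g
  degree : ∀ v ∈ U₀, (T.filter (v ∈ ·)).card = N

/-- The hyperedge weights `φ` on `U` arise from the model with triple weights `1 - ζ` and vertex
weights `lam` by fixing the states of a bounded number of vertices. -/
structure Admissible (U₀ : Finset V) (T : Finset (Finset V)) (ζ lam : ℝ) (K : ℕ)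
    (φ : Finset V → ℝ) (U : Finset V) : Prop where
  subset : U ⊆ U₀
  nonneg : ∀ h, 0 ≤ φ h
  le_one : ∀ h, φ h ≤ 1
  empty : φ ∅ = 1
  single_le : ∀ x, φ {x} ≤ lam
  pair : ∀ x y, x ≠ y → φ {x, y} ≠ 1 → ∃ v ∈ U₀ \ U, {v, x, y} ∈ T
  large : ∀ h, 3 ≤ h.card → φ h = if h ∈ T then 1 - ζ else 1
  exceptional : (U₀.filter fun x => x ∉ U ∨ φ {x} ≠ lam).card ≤ K

variable {U₀ U : Finset V} {T : Finset (Finset V)} {N K L : ℕ} {ζ lam : ℝ} {φ : Finset V → ℝ}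
  {v : V}

lemma Admissible.mono (hφ : Admissible U₀ T ζ lam K φ U) (hKL : K ≤ L) :
    Admissible U₀ T ζ lam L φ U := { hφ with exceptional := hφ.exceptional.trans hKL }

/-- The vertices whose state is fixed or whose weight may change when the state of `v` is fixed. -/
def touched (U₀ : Finset V) (lam : ℝ) (φ : Finset V → ℝ) (U : Finset V) (v : V) : Finset V :=
  U₀.filter fun x => x ∉ U ∨ φ {x} ≠ lam ∨ x = v ∨ φ {v, x} ≠ 1

lemma card_triple {v x y : V} (hT : IsLinearSystem U₀ T N) (h : {v, x, y} ∈ T) :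
    v ≠ x ∧ v ≠ y ∧ x ≠ y := by
  have := hT.card_eq _ h
  refine ⟨?_, ?_, ?_⟩ <;> rintro rfl
  · simp only [Finset.insert_eq_of_mem, Finset.mem_insert_self] at this
    exact absurd this (by have := Finset.card_le_two (a := v) (b := y); omega)
  · rw [Finset.insert_eq_of_mem (by simp : v ∈ ({x, v} : Finset V))] at this
    exact absurd this (by have := Finset.card_le_two (a := x) (b := v); omega)
  · rw [Finset.pair_eq_singleton] at this
    exact absurd this (by have := Finset.card_le_two (a := v) (b := x); omega)

lemma card_touched_le (hT : IsLinearSystem U₀ T N) (hφ : Admissible U₀ T ζ lam K φ U) (v : V) :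
    (touched U₀ lam φ U v).card ≤ 2 * K + 1 := by
  have hsub : touched U₀ lam φ U v ⊆ (U₀.filter fun x => x ∉ U ∨ φ {x} ≠ lam) ∪
      ({v} ∪ U₀.filter fun x => x ≠ v ∧ φ {v, x} ≠ 1) := by
    intro x hx
    simp only [touched, Finset.mem_filter, Finset.mem_union, Finset.mem_singleton] at hx ⊢
    tauto
  have hpairs : (U₀.filter fun x => x ≠ v ∧ φ {v, x} ≠ 1).card ≤
      (U₀.filter fun x => x ∉ U ∨ φ {x} ≠ lam).card := by
    have hex : ∀ x ∈ U₀.filter (fun x => x ≠ v ∧ φ {v, x} ≠ 1), ∃ w ∈ U₀ \ U, {w, v, x} ∈ T := by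
      intro x hx
      simp only [Finset.mem_filter] at hx
      exact hφ.pair v x hx.2.1.symm hx.2.2
    choose! f hf using hex
    refine Finset.card_le_card_of_injOn f ?_ ?_
    · intro x hx
      have := (hf x hx).1
      simp only [Finset.mem_sdiff, Finset.mem_filter, Finset.mem_coe] at this ⊢
      exact ⟨this.1, Or.inl this.2⟩
    · intro x hx y hy hxy
      have h1 := (hf x hx).2
      have h2 := (hf y hy).2
      rw [← hxy] at h2
      have hd := card_triple hT h1
      have hd2 := card_triple hT h2
      have := hT.linear _ h1 _ h2 (f x) v hd.1 (by simp) (by simp) (by simp) (by simp)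
      have hy' : y ∈ ({f x, v, x} : Finset V) := by rw [this]; simp
      simp only [Finset.mem_insert, Finset.mem_singleton] at hy'
      rcases hy' with h | h | h
      · exact absurd h.symm hd2.2.1
      · exact absurd h.symm hd2.2.2
      · exact h.symm
  have := hφ.exceptional
  have h1 := Finset.card_le_card hsub
  have h2 := Finset.card_union_le (U₀.filter fun x => x ∉ U ∨ φ {x} ≠ lam)
    ({v} ∪ U₀.filter fun x => x ≠ v ∧ φ {v, x} ≠ 1)
  have h3 := Finset.card_union_le {v} (U₀.filter fun x => x ≠ v ∧ φ {v, x} ≠ 1)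
  rw [Finset.card_singleton] at h3
  omega

variable [Fintype V]

lemma Admissible.twist_erase (hT : IsLinearSystem U₀ T N) (hφ : Admissible U₀ T ζ lam K φ U)
    (hv : v ∈ U) (A : Finset (Finset V)) :
    Admissible U₀ T ζ lam (2 * K + 1) (twist φ v A) (U.erase v) where
  subset := (Finset.erase_subset v U).trans hφ.subset
  nonneg := twist_nonneg hφ.nonneg v A
  le_one h := (twist_le hφ.nonneg hφ.le_one v A h).trans (hφ.le_one h)
  empty := by rw [twist_apply_empty, hφ.empty]
  single_le x := (twist_le hφ.nonneg hφ.le_one v A _).trans (hφ.single_le x)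
  pair x y hxy h := by
    by_cases h1 : φ {x, y} = 1
    · have h2 : v ∉ ({x, y} : Finset V) ∧ φ {v, x, y} ≠ 1 := by
        by_contra hcon
        apply h
        rw [twist, h1, one_mul]
        split_ifs with hc
        · by_contra h3
          exact hcon ⟨hc.2.2, h3⟩
        · rfl
      have hcard : ({v, x, y} : Finset V).card = 3 := by
        rw [Finset.card_insert_of_notMem h2.1, Finset.card_pair hxy]
      refine ⟨v, by simp [hφ.subset hv], ?_⟩
      by_contra h3
      exact h2.2 (by rw [hφ.large _ hcard.ge, if_neg h3])
    · obtain ⟨w, hw, hwT⟩ := hφ.pair x y hxy h1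
      refine ⟨w, ?_, hwT⟩
      simp only [Finset.mem_sdiff, Finset.mem_erase, not_and] at hw ⊢
      exact ⟨hw.1, fun _ => hw.2⟩
  large h hh := by
    rw [twist]
    split_ifs with hc hhT hhT
    · rw [hφ.large h hh, if_pos hhT, hφ.large _ (hh.trans (Finset.card_le_card
        (Finset.subset_insert v h))), if_neg, mul_one]
      intro hT'
      have := hT.card_eq _ hT'
      rw [Finset.card_insert_of_notMem hc.2.2] at this
      omega
    · rw [hφ.large h hh, if_neg hhT, hφ.large _ (hh.trans (Finset.card_le_card
        (Finset.subset_insert v h))), if_neg, mul_one]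
      intro hT'
      have := hT.card_eq _ hT'
      rw [Finset.card_insert_of_notMem hc.2.2] at this
      omega
    · rw [hφ.large h hh, if_pos hhT, mul_one]
    · rw [hφ.large h hh, if_neg hhT, mul_one]
  exceptional := by
    refine (Finset.card_le_card fun x hx => ?_).trans (card_touched_le hT hφ v)
    simp only [touched, Finset.mem_filter, Finset.mem_erase, not_and_or, not_not] at hx ⊢
    refine ⟨hx.1, ?_⟩
    rcases hx.2 with (h | h) | h
    · exact Or.inr (Or.inr (Or.inl h))
    · exact Or.inl h
    · by_contra hcon
      simp only [not_or, not_not] at hcon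
      apply h
      rw [twist, hcon.2.1, hcon.2.2.2, ite_self, mul_one]

/-- The pairs which form a triple together with `v`. -/
def linkPairs (T : Finset (Finset V)) (v : V) : Finset (Finset V) :=
  (T.filter (v ∈ ·)).image (·.erase v)

lemma mem_linkPairs {h : Finset V} : h ∈ linkPairs T v ↔ v ∉ h ∧ insert v h ∈ T := by
  simp only [linkPairs, Finset.mem_image, Finset.mem_filter]
  constructor
  · rintro ⟨g, ⟨hg, hvg⟩, rfl⟩
    exact ⟨Finset.notMem_erase v g, by rwa [Finset.insert_erase hvg]⟩
  · rintro ⟨hv, hT⟩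
    exact ⟨insert v h, ⟨hT, Finset.mem_insert_self v h⟩, Finset.erase_insert hv⟩

lemma card_linkPairs (hT : IsLinearSystem U₀ T N) (hv : v ∈ U₀) : (linkPairs T v).card = N := by
  rw [linkPairs, Finset.card_image_of_injOn, hT.degree v hv]
  intro g hg g' hg' heq
  simp only [Finset.coe_filter, Set.mem_ofPred_eq] at hg hg'
  rw [← Finset.insert_erase hg.2, ← Finset.insert_erase hg'.2]
  exact congrArg (insert v) heq

lemma card_bad_linkPairs_le (hT : IsLinearSystem U₀ T N) (E : Finset V) :
    ((linkPairs T v).filter fun h => ¬ Disjoint h E).card ≤ E.card := by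
  have hex : ∀ h ∈ (linkPairs T v).filter (fun h => ¬ Disjoint h E), ∃ x ∈ E, x ∈ h := by
    intro h hh
    obtain ⟨x, hx, hxE⟩ := Finset.not_disjoint_iff.1 (Finset.mem_filter.1 hh).2
    exact ⟨x, hxE, hx⟩
  have : Nonempty V := ⟨v⟩
  choose! f hf using hex
  refine Finset.card_le_card_of_injOn f (fun h hh => (hf h hh).1) ?_
  intro h hh g hg hhg
  have h1 := (hf h hh).2
  have h2 := (hf g hg).2
  rw [← hhg] at h2
  have h3 := mem_linkPairs.1 (Finset.mem_filter.1 hh).1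
  have h4 := mem_linkPairs.1 (Finset.mem_filter.1 hg).1
  have hne : v ≠ f h := fun hv => h3.1 (hv ▸ h1)
  have := hT.linear _ h3.2 _ h4.2 v (f h) hne (Finset.mem_insert_self _ _)
    (Finset.mem_insert_of_mem h1) (Finset.mem_insert_self _ _) (Finset.mem_insert_of_mem h2)
  rw [← Finset.erase_insert h3.1, this, Finset.erase_insert h4.1]

/-- Bounds for the occupation probability of a vertex of weight `lam`, uniformly over all
models with at most `K` exceptional vertices. -/
def ProbBounds (U₀ : Finset V) (T : Finset (Finset V)) (ζ lam : ℝ) (K : ℕ) (l u : ℝ) : Prop :=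
  ∀ φ U x, Admissible U₀ T ζ lam K φ U → x ∈ U → φ {x} = lam →
    l ≤ prob φ U {x} ∧ prob φ U {x} ≤ u

lemma touched_twist {A : Finset (Finset V)} {x : V} (hx : x ∈ U₀)
    (hxE : x ∉ touched U₀ lam φ U v) : x ∈ U.erase v ∧ twist φ v A {x} = lam := by
  simp only [touched, Finset.mem_filter, hx, true_and, not_or, not_not] at hxE
  refine ⟨Finset.mem_erase.2 ⟨hxE.2.2.1, hxE.1⟩, ?_⟩
  rw [twist, hxE.2.1, hxE.2.2.2, ite_self, mul_one]

lemma prob_good_pair (hT : IsLinearSystem U₀ T N) {l u : ℝ} (hl : 0 ≤ l)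
    (H : ProbBounds U₀ T ζ lam (4 * K + 3) l u) (hφ : Admissible U₀ T ζ lam K φ U) (hv : v ∈ U)
    {A : Finset (Finset V)} {h : Finset V} (hh : h ∈ linkPairs T v) (hA : h ∉ A)
    (hE : Disjoint h (touched U₀ lam φ U v)) :
    l ^ 2 ≤ prob (twist φ v A) (U.erase v) h ∧ prob (twist φ v A) (U.erase v) h ≤ u ^ 2 := by
  obtain ⟨hvh, hhT⟩ := mem_linkPairs.1 hh
  have hcard : h.card = 2 := by
    have := hT.card_eq _ hhT
    rw [Finset.card_insert_of_notMem hvh] at this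
    omega
  obtain ⟨x, y, hxy, rfl⟩ := Finset.card_eq_two.1 hcard
  have hsub := hT.subset _ hhT
  have hx0 : x ∈ U₀ := hsub (by simp)
  have hy0 : y ∈ U₀ := hsub (by simp)
  have hxE : x ∉ touched U₀ lam φ U v := Finset.disjoint_left.1 hE (by simp)
  have hyE : y ∉ touched U₀ lam φ U v := Finset.disjoint_left.1 hE (by simp)
  obtain ⟨hxU, hxl⟩ := touched_twist (A := A) hx0 hxE
  obtain ⟨hyU, hyl⟩ := touched_twist (A := A) hy0 hyE
  have had := hφ.twist_erase hT hv A
  have had' := had.twist_erase hT hxU Finset.univ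
  have hpair : φ {x, y} = 1 := by
    by_contra hne
    obtain ⟨w, hw, hwT⟩ := hφ.pair x y hxy hne
    have := hT.linear _ hwT _ hhT x y hxy (by simp) (by simp) (by simp) (by simp)
    have hvw : v ∈ ({w, x, y} : Finset V) := by rw [this]; simp
    have hvw' : v = w := by
      rw [Finset.mem_insert] at hvw
      exact hvw.resolve_right hvh
    exact (Finset.mem_sdiff.1 hw).2 (hvw' ▸ hv)
  have hlink : twist (twist φ v A) x Finset.univ {y} = lam := by
    rw [twist, hyl]
    have : twist φ v A {x, y} = 1 := by
      rw [twist, if_neg (fun hc => hA hc.1), hpair, mul_one]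
    rw [this, ite_self, mul_one]
  have h1 := H _ _ x (had.mono (by omega)) hxU hxl
  have h2 := H _ _ y (had'.mono (by omega)) (Finset.mem_erase.2 ⟨hxy.symm, hyU⟩) hlink
  rw [show ({x, y} : Finset V) = insert x {y} from rfl,
    prob_insert had.nonneg had.empty hxU (by simpa using hxy), sq, sq]
  exact ⟨mul_le_mul h1.1 h2.1 hl (hl.trans h1.1),
    mul_le_mul h1.2 h2.2 (hl.trans h2.1) ((hl.trans h1.1).trans h1.2)⟩

lemma factor_of_mem_linkPairs (hT : IsLinearSystem U₀ T N) (hφ : Admissible U₀ T ζ lam K φ U)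
    {h : Finset V} (hh : h ∈ linkPairs T v) : factor φ v h = 1 - ζ := by
  obtain ⟨hvh, hhT⟩ := mem_linkPairs.1 hh
  have hcard := hT.card_eq _ hhT
  have hne : h ≠ ∅ := by
    rintro rfl
    simp at hcard
  rw [factor, if_pos ⟨hne, hvh⟩, hφ.large _ hcard.ge, if_pos hhT]

lemma factor_eq_one (hT : IsLinearSystem U₀ T N) (hφ : Admissible U₀ T ζ lam K φ U)
    {h : Finset V} (hh : h ∉ linkPairs T v)
    (hE : h ∉ (touched U₀ lam φ U v).image fun x => {x}) : factor φ v h = 1 := by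
  rw [factor]
  split_ifs with hc
  · by_contra hne
    rcases Nat.lt_or_ge 1 h.card with hcard | hcard
    · have h3 : 3 ≤ (insert v h).card := by
        rw [Finset.card_insert_of_notMem hc.2]
        omega
      rw [hφ.large _ h3, if_neg fun hhT => hh (mem_linkPairs.2 ⟨hc.2, hhT⟩)] at hne
      exact hne rfl
    · obtain ⟨x, rfl⟩ := Finset.card_eq_one.1
        (le_antisymm hcard (Finset.card_pos.2 (Finset.nonempty_iff_ne_empty.2 hc.1)))
      have hvx : v ≠ x := fun hvx => hc.2 (by simp [hvx])
      obtain ⟨w, -, hwT⟩ := hφ.pair v x hvx hne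
      apply hE
      simp only [touched, Finset.mem_image, Finset.mem_filter]
      exact ⟨x, ⟨hT.subset _ hwT (by simp), Or.inr (Or.inr (Or.inr hne))⟩, rfl⟩
  · rfl

lemma ratio_bounds (hT : IsLinearSystem U₀ T N) (hζ : 0 ≤ ζ) (hζ1 : ζ ≤ 1) (hlam1 : lam ≤ 1)
    {l u : ℝ} (hl : 0 ≤ l) (hl1 : l ≤ 1) (hu : 0 ≤ u) (hu1 : u ≤ 1)
    (H : ProbBounds U₀ T ζ lam (4 * K + 3) l u) (hφ : Admissible U₀ T ζ lam K φ U) (hv : v ∈ U) :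
    (1 - ζ * u ^ 2) ^ N * (1 - lam) ^ (4 * K + 2) ≤ ratio φ U v ∧
      ratio φ U v ≤ (1 - ζ * l ^ 2) ^ (N - (2 * K + 1)) := by
  set E := touched U₀ lam φ U v with hEdef
  set good := (linkPairs T v).filter fun h => Disjoint h E with hgood
  set bad := ((linkPairs T v).filter fun h => ¬ Disjoint h E) ∪ E.image fun x => {x} with hbad
  have hu2 : ζ * u ^ 2 ≤ 1 := mul_le_one₀ hζ1 (sq_nonneg u) (pow_le_one₀ hu hu1)
  have hl2 : ζ * l ^ 2 ≤ 1 := mul_le_one₀ hζ1 (sq_nonneg l) (pow_le_one₀ hl hl1)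
  have hlam : 0 ≤ lam := (hφ.nonneg {v}).trans (hφ.single_le v)
  have hEcard : E.card ≤ 2 * K + 1 := card_touched_le hT hφ v
  have hbadpairs := card_bad_linkPairs_le (v := v) hT E
  have hgoodbad : good.card + ((linkPairs T v).filter fun h => ¬ Disjoint h E).card = N := by
    rw [hgood, Finset.card_filter_add_card_filter_not, card_linkPairs hT (hφ.subset hv)]
  have hbadcard : bad.card ≤ 4 * K + 2 := by
    have h1 := Finset.card_union_le ((linkPairs T v).filter fun h => ¬ Disjoint h E)
      (E.image fun x => ({x} : Finset V))
    have h2 : (E.image fun x => ({x} : Finset V)).card ≤ E.card := Finset.card_image_le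
    rw [hbad]
    omega
  have hbadprob : ∀ (A : Finset (Finset V)) (h : Finset V), h.Nonempty →
      prob (twist φ v A) (U.erase v) h ≤ lam := by
    intro A h ⟨x, hx⟩
    have had := hφ.twist_erase hT hv A
    refine (prob_anti had.nonneg had.empty (Finset.singleton_subset_iff.2 hx)).trans ?_
    by_cases hxU : x ∈ U.erase v
    · exact (prob_singleton_le had.nonneg had.le_one had.empty hxU).trans (had.single_le x)
    · rw [prob, mass_of_not_subset (by simpa using hxU), zero_div]
      exact hlam
  have hprob0 : ∀ (A : Finset (Finset V)) (h : Finset V),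
      0 ≤ prob (twist φ v A) (U.erase v) h := fun A h =>
    prob_nonneg (hφ.twist_erase hT hv A).nonneg (hφ.twist_erase hT hv A).empty _ _
  have hbadne : ∀ h ∈ bad, h.Nonempty := by
    intro h hh
    rcases Finset.mem_union.1 hh with hh | hh
    · obtain ⟨x, hx, -⟩ := Finset.not_disjoint_iff.1 (Finset.mem_filter.1 hh).2
      exact ⟨x, hx⟩
    · obtain ⟨x, -, rfl⟩ := Finset.mem_image.1 hh
      exact Finset.singleton_nonempty x
  have hgoodnotbad : ∀ h ∈ good, h ∉ bad := by
    intro h hh hhb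
    rcases Finset.mem_union.1 hhb with hhb | hhb
    · exact (Finset.mem_filter.1 hhb).2 (Finset.mem_filter.1 hh).2
    · obtain ⟨x, hx, rfl⟩ := Finset.mem_image.1 hhb
      exact Finset.disjoint_left.1 (Finset.mem_filter.1 hh).2 (by simp) hx
  have hneither : ∀ h, h ∉ good → h ∉ bad → factor φ v h = 1 := by
    intro h hg hb
    rw [hbad, Finset.mem_union, not_or] at hb
    refine factor_eq_one hT hφ (fun hh => ?_) hb.2
    by_cases hd : Disjoint h E
    · exact hg (Finset.mem_filter.2 ⟨hh, hd⟩)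
    · exact hb.1 (Finset.mem_filter.2 ⟨hh, hd⟩)
  have key := prod_le_partition_twist (U := U.erase v) (v := v) hφ.nonneg hφ.empty
    (fun h => (if h ∈ good then 1 - ζ * u ^ 2 else 1) * (if h ∈ bad then 1 - lam else 1))
    (fun h => if h ∈ good then 1 - ζ * l ^ 2 else 1) ?_ ?_ ?_ Finset.univ
  · have hpos : 0 < partition φ (U.erase v) :=
      zero_lt_one.trans_le (one_le_partition hφ.nonneg hφ.empty _)
    rw [Finset.prod_mul_distrib, Finset.prod_ite_mem, Finset.prod_ite_mem, Finset.univ_inter,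
      Finset.univ_inter, Finset.prod_const, Finset.prod_const, ← le_div_iff₀ hpos] at key
    rw [Finset.prod_ite_mem, Finset.univ_inter, Finset.prod_const, ← div_le_iff₀ hpos] at key
    refine ⟨le_trans ?_ key.1, key.2.trans ?_⟩
    · refine mul_le_mul ?_ ?_ (pow_nonneg (by linarith) _) (pow_nonneg (by linarith) _)
      · exact pow_le_pow_of_le_one (by linarith) (by linarith [mul_nonneg hζ (sq_nonneg u)])
          (by omega)
      · exact pow_le_pow_of_le_one (by linarith) (by linarith) hbadcard
    · exact pow_le_pow_of_le_one (by linarith) (by linarith [mul_nonneg hζ (sq_nonneg l)])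
        (by omega)
  · intro h
    refine mul_nonneg ?_ ?_ <;> split_ifs <;> linarith
  · intro A h hA
    by_cases hg : h ∈ good
    · have hg' := Finset.mem_filter.1 hg
      have := (prob_good_pair hT hl H hφ hv hg'.1 hA hg'.2).2
      simp only [hg, hgoodnotbad h hg, if_true, if_false, mul_one,
        factor_of_mem_linkPairs hT hφ hg'.1]
      nlinarith
    · by_cases hb : h ∈ bad
      · simp only [hg, hb, if_true, if_false, one_mul]
        nlinarith [hbadprob A h (hbadne h hb), hprob0 A h, factor_nonneg hφ.nonneg v h]
      · simp [hg, hb, hneither h hg hb]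
  · intro A h hA
    by_cases hg : h ∈ good
    · have hg' := Finset.mem_filter.1 hg
      have := (prob_good_pair hT hl H hφ hv hg'.1 hA hg'.2).1
      simp only [hg, if_true, factor_of_mem_linkPairs hT hφ hg'.1]
      nlinarith
    · simp only [hg, if_false]
      nlinarith [hprob0 A h, factor_le_one hφ.le_one v h]

/-- One step of the recursion for occupation probabilities. -/
lemma ProbBounds.step (hT : IsLinearSystem U₀ T N) (hζ : 0 ≤ ζ) (hζ1 : ζ ≤ 1) (hlam1 : lam ≤ 1)
    {l u : ℝ} (hl : 0 ≤ l) (hl1 : l ≤ 1) (hu : 0 ≤ u) (hu1 : u ≤ 1)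
    (H : ProbBounds U₀ T ζ lam (4 * K + 3) l u) :
    ProbBounds U₀ T ζ lam K
      (lam * ((1 - ζ * u ^ 2) ^ N * (1 - lam) ^ (4 * K + 2)) / (1 + lam))
      (lam * (1 - ζ * l ^ 2) ^ (N - (2 * K + 1))) := by
  intro φ U v hφ hv hvl
  have hlam : 0 ≤ lam := (hφ.nonneg {v}).trans (hφ.single_le v)
  obtain ⟨h1, h2⟩ := ratio_bounds hT hζ hζ1 hlam1 hl hl1 hu hu1 H hφ hv
  have hr := ratio_nonneg (U := U) (v := v) hφ.nonneg hφ.empty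
  have hr1 := ratio_le_one (U := U) (v := v) hφ.nonneg hφ.le_one hφ.empty
  rw [prob_singleton hφ.nonneg hφ.empty hv, hvl]
  constructor
  · exact div_le_div₀ (mul_nonneg hlam hr) (mul_le_mul_of_nonneg_left h1 hlam)
      (by linarith [mul_nonneg hlam hr]) (by linarith [mul_le_of_le_one_right hlam hr1])
  · exact (div_le_self (mul_nonneg hlam hr) (by linarith [mul_nonneg hlam hr])).trans
      (mul_le_mul_of_nonneg_left h2 hlam)

lemma ProbBounds.trivial (U₀ : Finset V) (T : Finset (Finset V)) (ζ lam : ℝ) (K : ℕ) :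
    ProbBounds U₀ T ζ lam K 0 lam := fun _ _ x hφ hx _ =>
  ⟨prob_nonneg hφ.nonneg hφ.empty _ _,
    (prob_singleton_le hφ.nonneg hφ.le_one hφ.empty hx).trans (hφ.single_le x)⟩

end Triples

/-! ### Asymptotics of the recursion -/

section Asymptotics

open Topology

lemma tendsto_of_sqrt_mul {u : ℕ → ℝ} {b : ℝ}
    (hu : Tendsto (fun n : ℕ => Real.sqrt n * u n) atTop (𝓝 b)) : Tendsto u atTop (𝓝 0) := by
  have hs : Tendsto (fun n : ℕ => (Real.sqrt n)⁻¹) atTop (𝓝 0) :=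
    (Real.tendsto_sqrt_atTop.comp tendsto_natCast_atTop_atTop).inv_tendsto_atTop
  have := hs.mul hu
  rw [zero_mul] at this
  refine this.congr' ?_
  filter_upwards [eventually_gt_atTop 0] with n hn
  have : Real.sqrt n ≠ 0 := (Real.sqrt_pos.2 (Nat.cast_pos.2 hn)).ne'
  field_simp

lemma tendsto_one_sub_pow {u : ℕ → ℝ} {b ζ : ℝ} (m : ℕ)
    (hu : Tendsto (fun n : ℕ => Real.sqrt n * u n) atTop (𝓝 b)) :
    Tendsto (fun n : ℕ => (1 - ζ * u n ^ 2) ^ (n - m)) atTop (𝓝 (Real.exp (-(ζ * b ^ 2)))) := by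
  have hu0 := tendsto_of_sqrt_mul hu
  have hg : Tendsto (fun n : ℕ => (n : ℝ) * -(ζ * u n ^ 2)) atTop (𝓝 (-(ζ * b ^ 2))) := by
    refine (((hu.pow 2).const_mul ζ).neg).congr fun n => ?_
    rw [mul_pow, Real.sq_sqrt (Nat.cast_nonneg n)]
    ring
  have hexp := Real.tendsto_one_add_pow_exp_of_tendsto hg
  have hbase : Tendsto (fun n : ℕ => 1 + -(ζ * u n ^ 2)) atTop (𝓝 1) := by
    have := (((hu0.pow 2).const_mul ζ).neg).const_add 1
    simpa using this
  have hdiv := hexp.div (hbase.pow m) (by simp)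
  rw [one_pow, div_one] at hdiv
  refine hdiv.congr' ?_
  filter_upwards [eventually_ge_atTop m, hbase.eventually_ne one_ne_zero] with n hn hne
  simp only [Pi.div_apply, ← sub_eq_add_neg] at hne ⊢
  rw [pow_sub₀ _ hne hn, div_eq_mul_inv]

lemma abs_fixedPoint_map_sub_le {c ζ a t : ℝ} (hζ : 0 ≤ ζ) (ha : 0 ≤ a)
    (hac : a * Real.exp (ζ * a ^ 2) = c) (ht : 0 ≤ t) (htc : t ≤ c) :
    |c * Real.exp (-(ζ * t ^ 2)) - a| ≤ 2 * ζ * c ^ 2 * |t - a| := by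
  have hexp : (1 : ℝ) ≤ Real.exp (ζ * a ^ 2) := Real.one_le_exp (by positivity)
  have hc : 0 ≤ c := ht.trans htc
  have hle : a ≤ c := by rw [← hac]; exact le_mul_of_one_le_right ha hexp
  have hfix : a = c * Real.exp (-(ζ * a ^ 2)) := by
    rw [← hac, mul_assoc, ← Real.exp_add, add_neg_cancel, Real.exp_zero, mul_one]
  have hlip : ∀ x y : ℝ, 0 ≤ x → x ≤ y → |Real.exp (-x) - Real.exp (-y)| ≤ y - x := by
    intro x y hx hxy
    rw [abs_of_nonneg (sub_nonneg.2 (Real.exp_le_exp.2 (by linarith)))]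
    have h1 : Real.exp (-y) = Real.exp (-x) * Real.exp (x - y) := by
      rw [← Real.exp_add]; ring_nf
    have h2 := Real.add_one_le_exp (x - y)
    have h3 : Real.exp (-x) ≤ 1 := Real.exp_le_one_iff.2 (by linarith)
    have h4 := Real.exp_pos (-x)
    rw [h1]
    nlinarith
  have hlip' : |Real.exp (-(ζ * t ^ 2)) - Real.exp (-(ζ * a ^ 2))| ≤ |ζ * t ^ 2 - ζ * a ^ 2| := by
    rcases le_total (ζ * t ^ 2) (ζ * a ^ 2) with h | h
    · rw [abs_sub_comm (ζ * t ^ 2), abs_of_nonneg (sub_nonneg.2 h)]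
      exact hlip _ _ (by positivity) h
    · rw [abs_sub_comm, abs_of_nonneg (sub_nonneg.2 h)]
      exact hlip _ _ (by positivity) h
  calc |c * Real.exp (-(ζ * t ^ 2)) - a|
      = c * |Real.exp (-(ζ * t ^ 2)) - Real.exp (-(ζ * a ^ 2))| := by
        conv_lhs => rw [hfix]
        rw [← mul_sub, abs_mul, abs_of_nonneg hc]
    _ ≤ c * |ζ * t ^ 2 - ζ * a ^ 2| := mul_le_mul_of_nonneg_left hlip' hc
    _ = c * (ζ * (t + a) * |t - a|) := by
        rw [show ζ * t ^ 2 - ζ * a ^ 2 = ζ * (t + a) * (t - a) by ring, abs_mul,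
          abs_of_nonneg (by positivity : 0 ≤ ζ * (t + a))]
    _ ≤ c * (ζ * (c + c) * |t - a|) := by gcongr
    _ = 2 * ζ * c ^ 2 * |t - a| := by ring

variable {V : ℕ → Type*} [∀ n, DecidableEq (V n)] [∀ n, Fintype (V n)]
  {U₀ : ∀ n, Finset (V n)} {T : ∀ n, Finset (Finset (V n))} {lam : ℕ → ℝ} {c ζ a : ℝ}

lemma exists_probBounds (hT : ∀ n, IsLinearSystem (U₀ n) (T n) (n - 2)) (hζ : 0 ≤ ζ) (hζ1 : ζ ≤ 1)
    (hlam : ∀ n, 0 < lam n) (hlc : Tendsto (fun n : ℕ => Real.sqrt n * lam n) atTop (𝓝 c))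
    (ha : 0 ≤ a) (hac : a * Real.exp (ζ * a ^ 2) = c) (k : ℕ) :
    ∃ l' u' : ℝ, (0 ≤ l' ∧ l' ≤ c ∧ |l' - a| ≤ (2 * ζ * c ^ 2) ^ k * c) ∧
      (0 ≤ u' ∧ u' ≤ c ∧ |u' - a| ≤ (2 * ζ * c ^ 2) ^ k * c) ∧
      ∀ K : ℕ, ∃ l u : ℕ → ℝ,
        Tendsto (fun n : ℕ => Real.sqrt n * l n) atTop (𝓝 l') ∧
        Tendsto (fun n : ℕ => Real.sqrt n * u n) atTop (𝓝 u') ∧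
        ∀ᶠ n in atTop, 0 ≤ l n ∧ 0 ≤ u n ∧
          ProbBounds (U₀ n) (T n) ζ (lam n) K (l n) (u n) := by
  have hexp : (1 : ℝ) ≤ Real.exp (ζ * a ^ 2) := Real.one_le_exp (by positivity)
  have hle : a ≤ c := by rw [← hac]; exact le_mul_of_one_le_right ha hexp
  have hc : 0 ≤ c := ha.trans hle
  have hlam0 := tendsto_of_sqrt_mul hlc
  induction k with
  | zero =>
    refine ⟨0, c, ⟨le_rfl, hc, ?_⟩, ⟨hc, le_rfl, ?_⟩, fun K => ⟨fun _ => 0, lam, by simp, hlc,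
      Eventually.of_forall fun n => ⟨le_rfl, (hlam n).le, ProbBounds.trivial _ _ _ _ _⟩⟩⟩
    · rw [pow_zero, one_mul, zero_sub, abs_neg, abs_of_nonneg ha]
      exact hle
    · rw [pow_zero, one_mul, abs_of_nonneg (sub_nonneg.2 hle)]
      linarith
  | succ k ih =>
    obtain ⟨l', u', ⟨hl0, hlc', hla⟩, ⟨hu0, huc, hua⟩, hK⟩ := ih
    have hmap : ∀ t, 0 ≤ t → t ≤ c → |t - a| ≤ (2 * ζ * c ^ 2) ^ k * c →
        0 ≤ c * Real.exp (-(ζ * t ^ 2)) ∧ c * Real.exp (-(ζ * t ^ 2)) ≤ c ∧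
          |c * Real.exp (-(ζ * t ^ 2)) - a| ≤ (2 * ζ * c ^ 2) ^ (k + 1) * c := by
      intro t ht htc hta
      refine ⟨by positivity, mul_le_of_le_one_right hc (Real.exp_le_one_iff.2 ?_), ?_⟩
      · linarith [mul_nonneg hζ (sq_nonneg t)]
      · refine (abs_fixedPoint_map_sub_le hζ ha hac ht htc).trans ?_
        calc 2 * ζ * c ^ 2 * |t - a| ≤ 2 * ζ * c ^ 2 * ((2 * ζ * c ^ 2) ^ k * c) := by gcongr
          _ = _ := by ring
    refine ⟨c * Real.exp (-(ζ * u' ^ 2)), c * Real.exp (-(ζ * l' ^ 2)), hmap u' hu0 huc hua,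
      hmap l' hl0 hlc' hla, fun K => ?_⟩
    obtain ⟨l, u, hl, hu, hev⟩ := hK (4 * K + 3)
    refine ⟨fun n => lam n * ((1 - ζ * u n ^ 2) ^ (n - 2) * (1 - lam n) ^ (4 * K + 2)) /
      (1 + lam n), fun n => lam n * (1 - ζ * l n ^ 2) ^ (n - 2 - (2 * K + 1)), ?_, ?_, ?_⟩
    · have h1 : Tendsto (fun n => (1 - lam n) ^ (4 * K + 2)) atTop (𝓝 1) := by
        simpa using (hlam0.const_sub 1).pow (4 * K + 2)
      have h2 : Tendsto (fun n => 1 + lam n) atTop (𝓝 1) := by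
        simpa using hlam0.const_add 1
      have h3 := (hlc.mul ((tendsto_one_sub_pow (ζ := ζ) 2 hu).mul h1)).div h2 one_ne_zero
      rw [mul_one, div_one] at h3
      refine h3.congr fun n => ?_
      simp only [Pi.div_apply]
      ring
    · refine (hlc.mul (tendsto_one_sub_pow (ζ := ζ) (2 + (2 * K + 1)) hl)).congr fun n => ?_
      simp only [Nat.sub_sub, mul_assoc]
    · have hl1 := (tendsto_of_sqrt_mul hl).eventually_le_const zero_lt_one
      have hu1 := (tendsto_of_sqrt_mul hu).eventually_le_const zero_lt_one
      filter_upwards [hev, hl1, hu1, hlam0.eventually_le_const zero_lt_one]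
        with n ⟨hl0, hu0, hB⟩ hl1 hu1 hlam1
      have hsq : ∀ t : ℝ, 0 ≤ t → t ≤ 1 → 0 ≤ 1 - ζ * t ^ 2 := fun t h0 h1 =>
        sub_nonneg.2 (mul_le_one₀ hζ1 (sq_nonneg t) (pow_le_one₀ h0 h1))
      have hlamn := (hlam n).le
      refine ⟨?_, mul_nonneg hlamn (pow_nonneg (hsq _ hl0 hl1) _),
        hB.step (hT n) hζ hζ1 hlam1 hl0 hl1 hu0 hu1⟩
      exact div_nonneg (mul_nonneg hlamn (mul_nonneg (pow_nonneg (hsq _ hu0 hu1) _)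
        (pow_nonneg (by linarith) _))) (by linarith)

/-- The hyperedge weights of the model in which no vertex is exceptional. -/
def baseWeight {V : Type*} [DecidableEq V] (T : Finset (Finset V)) (ζ lam : ℝ) (h : Finset V) : ℝ :=
  if h.card = 1 then lam else if h ∈ T then 1 - ζ else 1

lemma admissible_baseWeight {V : Type*} [DecidableEq V] {U₀ : Finset V} {T : Finset (Finset V)}
    {N : ℕ} {ζ lam : ℝ} (hT : IsLinearSystem U₀ T N) (hζ : 0 ≤ ζ) (hζ1 : ζ ≤ 1) (hlam : 0 ≤ lam)
    (hlam1 : lam ≤ 1) : Admissible U₀ T ζ lam 0 (baseWeight T ζ lam) U₀ where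
  subset := subset_rfl
  nonneg h := by unfold baseWeight; split_ifs <;> linarith
  le_one h := by unfold baseWeight; split_ifs <;> linarith
  empty := by
    have : (∅ : Finset V) ∉ T := fun h => by simpa using hT.card_eq _ h
    simp [baseWeight, this]
  single_le x := by simp [baseWeight]
  pair x y hxy h := by
    refine absurd ?_ h
    have : ({x, y} : Finset V) ∉ T := fun h => by
      simpa [Finset.card_pair hxy] using hT.card_eq _ h
    simp [baseWeight, Finset.card_pair hxy, this]
  large h hh := by rw [baseWeight, if_neg (by omega)]
  exceptional := by simp [baseWeight]

/-- All occupation probabilities are asymptotic to `a / √n`, uniformly. -/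
lemma eventually_abs_sqrt_mul_prob_sub_le (hT : ∀ n, IsLinearSystem (U₀ n) (T n) (n - 2))
    (hζ : 0 ≤ ζ) (hζ1 : ζ ≤ 1) (hlam : ∀ n, 0 < lam n)
    (hlc : Tendsto (fun n : ℕ => Real.sqrt n * lam n) atTop (𝓝 c))
    (ha : 0 ≤ a) (hac : a * Real.exp (ζ * a ^ 2) = c) (hζc : 2 * ζ * c ^ 2 < 1)
    {ε : ℝ} (hε : 0 < ε) :
    ∀ᶠ n in atTop, ∀ x ∈ U₀ n,
      |Real.sqrt n * prob (baseWeight (T n) ζ (lam n)) (U₀ n) {x} - a| ≤ ε := by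
  have hρ : Tendsto (fun k => (2 * ζ * c ^ 2) ^ k * c) atTop (𝓝 0) := by
    simpa using (tendsto_pow_atTop_nhds_zero_of_lt_one (by positivity) hζc).mul_const c
  obtain ⟨k, hk⟩ := (hρ.eventually_le_const (half_pos hε)).exists
  obtain ⟨l', u', ⟨-, -, hla⟩, ⟨-, -, hua⟩, hK⟩ := exists_probBounds hT hζ hζ1 hlam hlc ha hac k
  obtain ⟨l, u, hl, hu, hev⟩ := hK 0
  have hla' := abs_le.1 (hla.trans hk)
  have hua' := abs_le.1 (hua.trans hk)
  filter_upwards [hev, (tendsto_of_sqrt_mul hlc).eventually_le_const zero_lt_one,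
    hl.eventually_const_le (by linarith : a - ε < l'),
    hu.eventually_le_const (by linarith : u' < a + ε)] with n ⟨_, _, hB⟩ hlam1 hln hun x hx
  obtain ⟨h1, h2⟩ := hB _ _ x (admissible_baseWeight (hT n) hζ hζ1 (hlam n).le hlam1) hx
    (by simp [baseWeight])
  have h3 := mul_le_mul_of_nonneg_left h1 (Real.sqrt_nonneg n)
  have h4 := mul_le_mul_of_nonneg_left h2 (Real.sqrt_nonneg n)
  rw [abs_le]
  constructor <;> linarith

end Asymptotics

/-! ### The partition function of the unperturbed model -/

section Base

variable {V : Type*} [DecidableEq V] {U₀ U : Finset V} {T : Finset (Finset V)} {N : ℕ} {ζ lam : ℝ}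

lemma weight_baseWeight (hT : IsLinearSystem U₀ T N) (ζ lam : ℝ) (S : Finset V) :
    weight (baseWeight T ζ lam) S =
      lam ^ S.card * (1 - ζ) ^ (T.filter (· ⊆ S)).card := by
  have key : ∀ h, baseWeight T ζ lam h =
      (if h.card = 1 then lam else 1) * (if h ∈ T then 1 - ζ else 1) := by
    intro h
    unfold baseWeight
    split_ifs with h1 h2
    · rw [hT.card_eq h h2] at h1
      omega
    · rw [mul_one]
    · rw [one_mul]
    · rw [mul_one]
  unfold weight
  simp_rw [key]
  rw [Finset.prod_mul_distrib, Finset.prod_ite_mem, Finset.prod_const, ← Finset.prod_filter,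
    Finset.prod_const, ← Finset.powersetCard_eq_filter, Finset.card_powersetCard,
    Nat.choose_one_right]
  congr 3
  ext h
  simp [and_comm]

/-- The derivative of the partition function in the vertex weight. -/
def partitionDeriv (U : Finset V) (T : Finset (Finset V)) (ζ lam : ℝ) : ℝ :=
  ∑ S ∈ U.powerset, S.card * lam ^ (S.card - 1) * (1 - ζ) ^ (T.filter (· ⊆ S)).card

lemma partition_baseWeight (hT : IsLinearSystem U₀ T N) (ζ lam : ℝ) (U : Finset V) :
    partition (baseWeight T ζ lam) U =
      ∑ S ∈ U.powerset, lam ^ S.card * (1 - ζ) ^ (T.filter (· ⊆ S)).card :=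
  Finset.sum_congr rfl fun S _ => weight_baseWeight hT ζ lam S

lemma hasDerivAt_partition (hT : IsLinearSystem U₀ T N) (ζ lam : ℝ) (U : Finset V) :
    HasDerivAt (fun lam => partition (baseWeight T ζ lam) U) (partitionDeriv U T ζ lam) lam := by
  simp_rw [partition_baseWeight hT]
  exact HasDerivAt.fun_sum fun S _ => (hasDerivAt_pow S.card lam).mul_const _

lemma continuous_partitionDeriv (U : Finset V) (T : Finset (Finset V)) (ζ : ℝ) :
    Continuous (partitionDeriv U T ζ) := by
  unfold partitionDeriv
  fun_prop

lemma baseWeight_nonneg (hζ1 : ζ ≤ 1) (hlam : 0 ≤ lam) (h : Finset V) :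
    0 ≤ baseWeight T ζ lam h := by
  unfold baseWeight
  split_ifs <;> linarith

lemma baseWeight_empty (hT : IsLinearSystem U₀ T N) : baseWeight T ζ lam ∅ = 1 := by
  have : (∅ : Finset V) ∉ T := fun h => by simpa using hT.card_eq _ h
  simp [baseWeight, this]

lemma one_le_partition_baseWeight (hT : IsLinearSystem U₀ T N) (hζ1 : ζ ≤ 1) (hlam : 0 ≤ lam)
    (U : Finset V) : 1 ≤ partition (baseWeight T ζ lam) U :=
  one_le_partition (baseWeight_nonneg hζ1 hlam) (baseWeight_empty hT) U

lemma partition_baseWeight_zero (hT : IsLinearSystem U₀ T N) (ζ : ℝ) (U : Finset V) :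
    partition (baseWeight T ζ 0) U = 1 := by
  rw [partition, Finset.sum_eq_single ∅, weight_empty (baseWeight_empty hT)]
  · intro S _ hS
    rw [weight_baseWeight hT, zero_pow (Finset.card_ne_zero.2 (Finset.nonempty_iff_ne_empty.2 hS)),
      zero_mul]
  · intro h
    exact absurd (Finset.empty_mem_powerset U) h

lemma mul_partitionDeriv (hT : IsLinearSystem U₀ T N) (ζ lam : ℝ) (U : Finset V) :
    lam * partitionDeriv U T ζ lam = ∑ x ∈ U, mass (baseWeight T ζ lam) U {x} := by
  unfold partitionDeriv mass
  rw [Finset.sum_comm, Finset.mul_sum]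
  refine Finset.sum_congr rfl fun S hS => ?_
  simp only [Finset.singleton_subset_iff]
  rw [Finset.sum_ite_mem, Finset.inter_eq_right.2 (Finset.mem_powerset.1 hS), Finset.sum_const,
    weight_baseWeight hT, nsmul_eq_mul]
  rcases Nat.eq_zero_or_pos S.card with h | h
  · simp [h]
  · obtain ⟨m, hm⟩ := Nat.exists_eq_succ_of_ne_zero h.ne'
    rw [hm, Nat.succ_sub_one, pow_succ]
    ring

lemma partitionDeriv_div (hT : IsLinearSystem U₀ T N) (hlam : 0 < lam) (U : Finset V) :
    partitionDeriv U T ζ lam / partition (baseWeight T ζ lam) U =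
      (∑ x ∈ U, prob (baseWeight T ζ lam) U {x}) / lam := by
  simp only [prob]
  rw [← Finset.sum_div, ← mul_partitionDeriv hT]
  field_simp

lemma abs_partitionDeriv_div_le [Fintype V] (hT : IsLinearSystem U₀ T N) (hζ : 0 ≤ ζ)
    (hζ1 : ζ ≤ 1) (hlam : 0 < lam) (hlam1 : lam ≤ 1) :
    |partitionDeriv U₀ T ζ lam / partition (baseWeight T ζ lam) U₀| ≤ U₀.card := by
  have had := admissible_baseWeight hT hζ hζ1 hlam.le hlam1
  rw [partitionDeriv_div hT hlam, abs_of_nonneg (div_nonneg (Finset.sum_nonneg fun x _ =>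
    prob_nonneg had.nonneg had.empty _ _) hlam.le), div_le_iff₀ hlam, ← nsmul_eq_mul]
  exact Finset.sum_le_card_nsmul _ _ _ fun x hx =>
    (prob_singleton_le had.nonneg had.le_one had.empty hx).trans (had.single_le x)

end Base

/-! ### Triangles of the complete graph -/

section Complete

variable {V : Type*} [DecidableEq V]

/-- The edges of the complete graph on `t`. -/
def pairsIn (t : Finset V) : Finset (Sym2 V) := t.sym2.filter fun e => ¬ e.IsDiag

lemma mem_pairsIn {t : Finset V} {a b : V} : s(a, b) ∈ pairsIn t ↔ a ∈ t ∧ b ∈ t ∧ a ≠ b := by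
  simp [pairsIn, and_assoc]

lemma pairsIn_triple {a b c : V} (hab : a ≠ b) (hac : a ≠ c) (hbc : b ≠ c) :
    pairsIn {a, b, c} = {s(a, b), s(a, c), s(b, c)} := by
  ext e
  induction e with
  | h x y =>
    simp only [mem_pairsIn, Finset.mem_insert, Finset.mem_singleton, Sym2.eq_iff]
    grind

lemma card_pairsIn {t : Finset V} (ht : t.card = 3) : (pairsIn t).card = 3 := by
  obtain ⟨a, b, c, hab, hac, hbc, rfl⟩ := Finset.card_eq_three.1 ht
  rw [pairsIn_triple hab hac hbc, Finset.card_eq_three]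
  exact ⟨_, _, _, by simp [hbc, hac], by simp [hac, hab], by simp [hac, hab], rfl⟩

lemma eq_of_mem_pairsIn {t t' : Finset V} (ht : t.card = 3) (ht' : t'.card = 3) {e f : Sym2 V}
    (hef : e ≠ f) (he : e ∈ pairsIn t) (hf : f ∈ pairsIn t) (he' : e ∈ pairsIn t')
    (hf' : f ∈ pairsIn t') : t = t' := by
  obtain ⟨a, b, c, hab, hac, hbc, rfl⟩ := Finset.card_eq_three.1 ht
  have hsub : ({a, b, c} : Finset V) ⊆ t' := by
    rw [pairsIn_triple hab hac hbc] at he hf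
    simp only [Finset.mem_insert, Finset.mem_singleton] at he hf
    rcases he with rfl | rfl | rfl <;> rcases hf with rfl | rfl | rfl <;>
      simp only [mem_pairsIn] at he' hf' <;>
      simp_all [Finset.insert_subset_iff]
  exact Finset.eq_of_subset_of_card_le hsub (by rw [ht, ht'])

lemma pairsIn_injOn : Set.InjOn pairsIn {t : Finset V | t.card = 3} := by
  intro t ht t' ht' h
  obtain ⟨a, b, c, hab, hac, hbc, rfl⟩ := Finset.card_eq_three.1 ht
  have h1 : s(a, b) ∈ pairsIn {a, b, c} := by simp [mem_pairsIn, hab]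
  have h2 : s(a, c) ∈ pairsIn {a, b, c} := by simp [mem_pairsIn, hac]
  exact eq_of_mem_pairsIn ht ht' (by simp [hbc, hac]) h1 h2 (h ▸ h1) (h ▸ h2)

variable (V) [Fintype V]

/-- The edge sets of the triangles of the complete graph. -/
def triangles : Finset (Finset (Sym2 V)) := (Finset.powersetCard 3 Finset.univ).image pairsIn

lemma isLinearSystem_triangles :
    IsLinearSystem (pairsIn (Finset.univ : Finset V)) (triangles V) (Fintype.card V - 2) where
  card_eq h hh := by
    obtain ⟨t, ht, rfl⟩ := Finset.mem_image.1 hh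
    exact card_pairsIn (Finset.mem_powersetCard.1 ht).2
  subset h hh := by
    obtain ⟨t, ht, rfl⟩ := Finset.mem_image.1 hh
    exact Finset.filter_subset_filter _ (Finset.sym2_mono (Finset.subset_univ t))
  linear h hh g hg v x hvx hvh hxh hvg hxg := by
    obtain ⟨t, ht, rfl⟩ := Finset.mem_image.1 hh
    obtain ⟨t', ht', rfl⟩ := Finset.mem_image.1 hg
    rw [eq_of_mem_pairsIn (Finset.mem_powersetCard.1 ht).2 (Finset.mem_powersetCard.1 ht').2
      hvx hvh hxh hvg hxg]
  degree e he := by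
    induction e with
    | h a b =>
      have hab : a ≠ b := (mem_pairsIn.1 he).2.2
      have himage : (triangles V).filter (s(a, b) ∈ ·) =
          ({a, b}ᶜ : Finset V).image fun w => pairsIn {a, b, w} := by
        ext h
        simp only [triangles, Finset.mem_filter, Finset.mem_image, Finset.mem_powersetCard,
          Finset.subset_univ, true_and, Finset.mem_compl]
        constructor
        · rintro ⟨⟨t, ht, rfl⟩, hmem⟩
          obtain ⟨ha, hb, -⟩ := mem_pairsIn.1 hmem
          obtain ⟨w, hw⟩ := Finset.card_eq_one.1
            (by rw [Finset.card_sdiff_of_subset (by simp [Finset.insert_subset_iff, ha, hb]), ht,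
              Finset.card_pair hab] : (t \ {a, b}).card = 1)
          have hwmem : w ∈ t \ {a, b} := by simp [hw]
          refine ⟨w, (Finset.mem_sdiff.1 hwmem).2, ?_⟩
          congr 1
          refine Finset.eq_of_subset_of_card_le ?_ ?_
          · simp [Finset.insert_subset_iff, ha, hb, (Finset.mem_sdiff.1 hwmem).1]
          · have := (Finset.mem_sdiff.1 hwmem).2
            simp only [Finset.mem_insert, Finset.mem_singleton, not_or] at this
            rw [ht, Finset.card_eq_three.2 ⟨a, b, w, hab, Ne.symm this.1, Ne.symm this.2, rfl⟩]
        · rintro ⟨w, hw, rfl⟩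
          simp only [Finset.mem_insert, Finset.mem_singleton, not_or] at hw
          refine ⟨⟨_, Finset.card_eq_three.2 ⟨a, b, w, hab, Ne.symm hw.1, Ne.symm hw.2, rfl⟩, rfl⟩, ?_⟩
          simp [mem_pairsIn, hab]
      rw [himage, Finset.card_image_of_injOn, Finset.card_compl, Finset.card_pair hab]
      intro w hw w' hw' heq
      simp only [Finset.coe_compl, Set.mem_compl_iff, Finset.mem_coe, Finset.mem_insert,
        Finset.mem_singleton, not_or] at hw hw'
      have hmem : s(a, w) ∈ pairsIn {a, b, w} := by
        rw [mem_pairsIn]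
        simp [Ne.symm hw.1]
      have heq' : pairsIn {a, b, w} = pairsIn {a, b, w'} := heq
      rw [heq', mem_pairsIn] at hmem
      simpa [hw.1, hw.2] using hmem.2.1

lemma card_pairsIn_univ : (pairsIn (Finset.univ : Finset V)).card = (Fintype.card V).choose 2 := by
  rw [← Sym2.card_subtype_not_diag, Fintype.card_subtype]
  simp [pairsIn]

end Complete

lemma triCount_eq_card_filter {n : ℕ} (G : SimpleGraph (Fin n)) :
    triCount G = ((triangles (Fin n)).filter (· ⊆ G.edgeFinset)).card := by
  rw [triCount, Nat.card_eq_fintype_card, Fintype.card_subtype]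
  have hclique : ∀ t : Finset (Fin n), G.IsNClique 3 t ↔
      t.card = 3 ∧ pairsIn t ⊆ G.edgeFinset := by
    intro t
    rw [SimpleGraph.isNClique_iff, and_comm, SimpleGraph.isClique_iff]
    refine and_congr_right fun _ => ⟨fun h e he => ?_, fun h a ha b hb hab => ?_⟩
    · induction e with
      | h a b =>
        obtain ⟨ha, hb, hab⟩ := mem_pairsIn.1 he
        rw [SimpleGraph.mem_edgeFinset, SimpleGraph.mem_edgeSet]
        exact h ha hb hab
    · have := h (mem_pairsIn.2 ⟨ha, hb, hab⟩)
      rwa [SimpleGraph.mem_edgeFinset, SimpleGraph.mem_edgeSet] at this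
  refine Finset.card_bij (fun t _ => pairsIn t) ?_ ?_ ?_
  · intro t ht
    have := (hclique t).1 (Finset.mem_filter.1 ht).2
    simp only [triangles, Finset.mem_filter, Finset.mem_image, Finset.mem_powersetCard,
      Finset.subset_univ, true_and]
    exact ⟨⟨t, this.1, rfl⟩, this.2⟩
  · intro t ht t' ht' h
    exact pairsIn_injOn ((hclique t).1 (Finset.mem_filter.1 ht).2).1
      ((hclique t').1 (Finset.mem_filter.1 ht').2).1 h
  · intro h hh
    simp only [triangles, Finset.mem_filter, Finset.mem_image, Finset.mem_powersetCard,
      Finset.subset_univ, true_and] at hh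
    obtain ⟨⟨t, ht, rfl⟩, hsub⟩ := hh
    exact ⟨t, Finset.mem_filter.2 ⟨Finset.mem_univ _, (hclique t).2 ⟨ht, hsub⟩⟩, rfl⟩

lemma Zfun_eq_partition (n : ℕ) (lam ζ : ℝ) :
    Zfun n lam ζ =
      partition (baseWeight (triangles (Fin n)) ζ lam) (pairsIn Finset.univ) := by
  have hT := isLinearSystem_triangles (Fin n)
  unfold Zfun partition
  refine Finset.sum_bij (fun G _ => G.edgeFinset) ?_ ?_ ?_ ?_
  · intro G _
    rw [Finset.mem_powerset]
    intro e he
    simp only [pairsIn, Finset.sym2_univ, Finset.mem_filter, Finset.mem_univ, true_and]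
    exact G.not_isDiag_of_mem_edgeFinset he
  · intro G _ H _ h
    exact SimpleGraph.edgeFinset_inj.1 h
  · intro S hS
    refine ⟨SimpleGraph.fromEdgeSet S, Finset.mem_univ _, ?_⟩
    ext e
    refine (@Set.mem_toFinset _ _ (_) _).trans ?_
    rw [SimpleGraph.edgeSet_fromEdgeSet, Set.mem_sdiff]
    refine ⟨fun h => h.1, fun h => ⟨h, ?_⟩⟩
    have := Finset.mem_powerset.1 hS h
    exact (Finset.mem_filter.1 this).2
  · intro G _
    rw [weight_baseWeight hT, gibbsWeight, triCount_eq_card_filter, edgeCount,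
      Nat.card_eq_fintype_card, SimpleGraph.edgeFinset_card]

/-! ### Integration along a curve of activities -/

section Integration

open Topology

/-- The activity at time `t`, relative to the activity at time `1`, whose fixed point is `a * t`. -/
def curve (ζ a t : ℝ) : ℝ := t * Real.exp (ζ * a ^ 2 * (t ^ 2 - 1))

/-- The derivative of `curve`. -/
def curveDeriv (ζ a t : ℝ) : ℝ :=
  (1 + 2 * ζ * a ^ 2 * t ^ 2) * Real.exp (ζ * a ^ 2 * (t ^ 2 - 1))

lemma hasDerivAt_curve (ζ a t : ℝ) : HasDerivAt (curve ζ a) (curveDeriv ζ a t) t := by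
  have h1 : HasDerivAt (fun t : ℝ => ζ * a ^ 2 * (t ^ 2 - 1)) (ζ * a ^ 2 * (2 * t)) t := by
    simpa using ((hasDerivAt_pow 2 t).sub_const 1).const_mul (ζ * a ^ 2)
  refine ((hasDerivAt_id t).mul h1.exp).congr_deriv ?_
  simp only [id, curveDeriv]
  ring

lemma continuous_curve (ζ a : ℝ) : Continuous (curve ζ a) := by
  unfold curve; fun_prop

lemma continuous_curveDeriv (ζ a : ℝ) : Continuous (curveDeriv ζ a) := by
  unfold curveDeriv; fun_prop

lemma exp_curve_le_one {ζ a t : ℝ} (hζ : 0 ≤ ζ) (ht0 : 0 ≤ t) (ht1 : t ≤ 1) :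
    Real.exp (ζ * a ^ 2 * (t ^ 2 - 1)) ≤ 1 := by
  refine Real.exp_le_one_iff.2 (mul_nonpos_of_nonneg_of_nonpos (by positivity) ?_)
  linarith [pow_le_one₀ ht0 ht1 (n := 2)]

lemma rpow_three_halves {x : ℝ} (hx : 0 ≤ x) : x ^ ((3 : ℝ) / 2) = x * Real.sqrt x := by
  rcases hx.eq_or_lt with rfl | hx
  · rw [Real.zero_rpow (by norm_num), zero_mul]
  · rw [show (3 : ℝ) / 2 = 1 + 1 / 2 by norm_num, Real.rpow_add hx, Real.rpow_one,
      Real.sqrt_eq_rpow]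

variable {V : ℕ → Type*} [∀ n, DecidableEq (V n)] [∀ n, Fintype (V n)]
  {U₀ : ∀ n, Finset (V n)} {T : ∀ n, Finset (Finset (V n))} {lam : ℕ → ℝ} {c ζ a : ℝ}

lemma tendsto_partitionDeriv_div (hT : ∀ n, IsLinearSystem (U₀ n) (T n) (n - 2))
    (hU : ∀ n, (U₀ n).card = n.choose 2) (hζ : 0 ≤ ζ) (hζ1 : ζ ≤ 1) (hlam : ∀ n, 0 < lam n)
    (hlc : Tendsto (fun n : ℕ => Real.sqrt n * lam n) atTop (𝓝 c))
    (ha : 0 ≤ a) (hac : a * Real.exp (ζ * a ^ 2) = c) (hζc : 2 * ζ * c ^ 2 < 1) :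
    Tendsto (fun n : ℕ => partitionDeriv (U₀ n) (T n) ζ (lam n) /
      partition (baseWeight (T n) ζ (lam n)) (U₀ n) * lam n / (n : ℝ) ^ ((3 : ℝ) / 2))
      atTop (𝓝 (a / 2)) := by
  have hsum : ∀ n, partitionDeriv (U₀ n) (T n) ζ (lam n) /
      partition (baseWeight (T n) ζ (lam n)) (U₀ n) * lam n =
      ∑ x ∈ U₀ n, prob (baseWeight (T n) ζ (lam n)) (U₀ n) {x} := fun n => by
    rw [partitionDeriv_div (hT n) (hlam n), div_mul_cancel₀ _ (hlam n).ne']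
  simp_rw [hsum]
  have hcard : Tendsto (fun n : ℕ => ((U₀ n).card : ℝ) / (n : ℝ) ^ 2) atTop (𝓝 (1 / 2)) := by
    have h : Tendsto (fun n : ℕ => (1 - (n : ℝ)⁻¹) / 2) atTop (𝓝 (1 / 2)) := by
      simpa using (tendsto_inv_atTop_nhds_zero_nat (𝕜 := ℝ)).const_sub 1 |>.div_const 2
    refine h.congr' ?_
    filter_upwards [eventually_gt_atTop 0] with n hn
    have : (n : ℝ) ≠ 0 := Nat.cast_ne_zero.2 hn.ne'
    rw [hU, Nat.cast_choose_two]
    field_simp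
  have hmain : Tendsto (fun n : ℕ => (∑ x ∈ U₀ n,
      (Real.sqrt n * prob (baseWeight (T n) ζ (lam n)) (U₀ n) {x} - a)) / (n : ℝ) ^ 2)
      atTop (𝓝 0) := by
    rw [Metric.tendsto_nhds]
    intro ε hε
    filter_upwards [eventually_abs_sqrt_mul_prob_sub_le hT hζ hζ1 hlam hlc ha hac hζc (half_pos hε),
      hcard.eventually_le_const (by norm_num : (1 / 2 : ℝ) < 1)] with n hn hcn
    rw [Real.dist_eq, sub_zero, abs_div, abs_of_nonneg (sq_nonneg (n : ℝ))]
    calc |∑ x ∈ U₀ n, (Real.sqrt n * prob (baseWeight (T n) ζ (lam n)) (U₀ n) {x} - a)| /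
          (n : ℝ) ^ 2
        ≤ ((U₀ n).card * (ε / 2)) / (n : ℝ) ^ 2 := by
          gcongr
          refine (Finset.abs_sum_le_sum_abs _ _).trans ?_
          rw [← nsmul_eq_mul]
          exact Finset.sum_le_card_nsmul _ _ _ hn
      _ = (U₀ n).card / (n : ℝ) ^ 2 * (ε / 2) := by ring
      _ ≤ 1 * (ε / 2) := by gcongr
      _ < ε := by linarith
  have hadd := hmain.add (hcard.mul_const a)
  rw [zero_add, one_div_mul_eq_div] at hadd
  refine hadd.congr' ?_
  filter_upwards [eventually_gt_atTop 0] with n hn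
  have hn' : (0 : ℝ) < n := Nat.cast_pos.2 hn
  have hs : 0 < Real.sqrt n := Real.sqrt_pos.2 hn'
  have hsq : Real.sqrt n * Real.sqrt n = n := Real.mul_self_sqrt hn'.le
  rw [rpow_three_halves hn'.le, Finset.sum_sub_distrib, ← Finset.mul_sum, Finset.sum_const,
    nsmul_eq_mul, div_add' _ _ _ (by positivity), div_eq_div_iff (by positivity) (by positivity)]
  set q := ∑ x ∈ U₀ n, prob (baseWeight (T n) ζ (lam n)) (U₀ n) {x}
  have : ((U₀ n).card : ℝ) / (n : ℝ) ^ 2 * a * (n : ℝ) ^ 2 = (U₀ n).card * a := by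
    field_simp
  rw [this]
  linear_combination q * n * hsq

lemma log_partition_eq_integral {V : Type*} [DecidableEq V] {U₀ : Finset V}
    {T : Finset (Finset V)} {N : ℕ} {lam : ℝ} (hT : IsLinearSystem U₀ T N) (hζ1 : ζ ≤ 1)
    (hlam : 0 < lam) :
    Real.log (partition (baseWeight T ζ lam) U₀) = ∫ t in (0 : ℝ)..1,
      partitionDeriv U₀ T ζ (lam * curve ζ a t) /
        partition (baseWeight T ζ (lam * curve ζ a t)) U₀ * (lam * curveDeriv ζ a t) := by
  have hcurve : ∀ t ∈ Set.uIcc (0 : ℝ) 1, 0 ≤ lam * curve ζ a t := by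
    intro t ht
    rw [Set.uIcc_of_le zero_le_one] at ht
    exact mul_nonneg hlam.le (mul_nonneg ht.1 (Real.exp_pos _).le)
  have hcont : Continuous fun μ => partition (baseWeight T ζ μ) U₀ :=
    continuous_iff_continuousAt.2 fun μ => (hasDerivAt_partition hT ζ μ U₀).continuousAt
  have hne : ∀ t ∈ Set.uIcc (0 : ℝ) 1, partition (baseWeight T ζ (lam * curve ζ a t)) U₀ ≠ 0 :=
    fun t ht => (zero_lt_one.trans_le (one_le_partition_baseWeight hT hζ1 (hcurve t ht) U₀)).ne'
  have hcc : Continuous fun t => lam * curve ζ a t := (continuous_curve ζ a).const_mul lam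
  rw [intervalIntegral.integral_eq_sub_of_hasDerivAt
    (f := fun t => Real.log (partition (baseWeight T ζ (lam * curve ζ a t)) U₀))]
  · simp [curve, partition_baseWeight_zero hT]
  · intro t ht
    have h1 := (hasDerivAt_curve ζ a t).const_mul lam
    have h2 : HasDerivAt (fun t => partition (baseWeight T ζ (lam * curve ζ a t)) U₀)
        (partitionDeriv U₀ T ζ (lam * curve ζ a t) * (lam * curveDeriv ζ a t)) t :=
      HasDerivAt.comp (h₂ := fun μ => partition (baseWeight T ζ μ) U₀) t
        (hasDerivAt_partition hT ζ (lam * curve ζ a t) U₀) h1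
    refine (h2.log (hne t ht)).congr_deriv ?_
    ring
  · refine ContinuousOn.intervalIntegrable (ContinuousOn.mul (ContinuousOn.div ?_ ?_ hne) ?_)
    · exact ((continuous_partitionDeriv U₀ T ζ).comp hcc).continuousOn
    · exact (hcont.comp hcc).continuousOn
    · exact ((continuous_curveDeriv ζ a).const_mul lam).continuousOn

lemma tendsto_log_partition (hT : ∀ n, IsLinearSystem (U₀ n) (T n) (n - 2))
    (hU : ∀ n, (U₀ n).card = n.choose 2) (hζ : 0 ≤ ζ) (hζ1 : ζ ≤ 1) (hlam : ∀ n, 0 < lam n)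
    (hlc : Tendsto (fun n : ℕ => Real.sqrt n * lam n) atTop (𝓝 c))
    (ha : 0 ≤ a) (hac : a * Real.exp (ζ * a ^ 2) = c) (hζc : 2 * ζ * c ^ 2 < 1) :
    Tendsto (fun n : ℕ => Real.log (partition (baseWeight (T n) ζ (lam n)) (U₀ n)) /
      (n : ℝ) ^ ((3 : ℝ) / 2)) atTop (𝓝 (a / 2 + ζ * a ^ 3 / 3)) := by
  have hc : 0 ≤ c := by rw [← hac]; positivity
  have hlim : ∫ t in (0 : ℝ)..1, (a / 2 + ζ * a ^ 3 * t ^ 2) = a / 2 + ζ * a ^ 3 / 3 := by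
    rw [intervalIntegral.integral_add (by simp) (Continuous.intervalIntegrable (by fun_prop) _ _),
      intervalIntegral.integral_const_mul, integral_pow]
    norm_num
    ring
  simp_rw [fun n => log_partition_eq_integral (a := a) (hT n) hζ1 (hlam n),
    ← intervalIntegral.integral_div]
  rw [← hlim]
  have hcurve : ∀ t ∈ Set.uIoc (0 : ℝ) 1, 0 < curve ζ a t ∧ curve ζ a t ≤ 1 := by
    intro t ht
    rw [Set.uIoc_of_le zero_le_one] at ht
    exact ⟨mul_pos ht.1 (Real.exp_pos _),
      mul_le_one₀ ht.2 (Real.exp_pos _).le (exp_curve_le_one hζ ht.1.le ht.2)⟩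
  refine intervalIntegral.tendsto_integral_filter_of_dominated_convergence
    (fun _ => (c + 1) * (1 + 2 * ζ * a ^ 2)) ?_ ?_ (by simp) ?_
  · refine Eventually.of_forall fun n => ?_
    have hcont : Continuous fun μ => partition (baseWeight (T n) ζ μ) (U₀ n) :=
      continuous_iff_continuousAt.2 fun μ => (hasDerivAt_partition (hT n) ζ μ _).continuousAt
    have hcc : Continuous fun t => lam n * curve ζ a t := (continuous_curve ζ a).const_mul _
    exact (((((continuous_partitionDeriv (U₀ n) (T n) ζ).comp hcc).measurable.div
      (hcont.comp hcc).measurable).mul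
      ((continuous_curveDeriv ζ a).const_mul (lam n)).measurable).div_const _).aestronglyMeasurable
  · filter_upwards [eventually_gt_atTop 0, hlc.eventually_le_const (by linarith : c < c + 1),
      (tendsto_of_sqrt_mul hlc).eventually_le_const zero_lt_one] with n hn hcn hlam1
    refine Eventually.of_forall fun t ht => ?_
    have hn' : (0 : ℝ) < n := Nat.cast_pos.2 hn
    have hs : 0 < Real.sqrt n := Real.sqrt_pos.2 hn'
    have hsq : Real.sqrt n * Real.sqrt n = n := Real.mul_self_sqrt hn'.le
    obtain ⟨hg0, hg1⟩ := hcurve t ht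
    rw [Set.uIoc_of_le zero_le_one] at ht
    have hlamn := hlam n
    have hD := abs_partitionDeriv_div_le (hT n) hζ hζ1 (mul_pos hlamn hg0)
      (mul_le_one₀ hlam1 hg0.le hg1)
    have hcardle : ((U₀ n).card : ℝ) ≤ (n : ℝ) ^ 2 := by
      rw [hU, Nat.cast_choose_two]
      nlinarith
    have hd0 : 0 ≤ curveDeriv ζ a t := by unfold curveDeriv; positivity
    have hd1 : curveDeriv ζ a t ≤ 1 + 2 * ζ * a ^ 2 := by
      have h1 := exp_curve_le_one (a := a) hζ ht.1.le ht.2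
      have h2 : 2 * ζ * a ^ 2 * t ^ 2 ≤ 2 * ζ * a ^ 2 :=
        mul_le_of_le_one_right (by positivity) (pow_le_one₀ ht.1.le ht.2)
      unfold curveDeriv
      calc _ ≤ (1 + 2 * ζ * a ^ 2 * t ^ 2) * 1 := by gcongr
        _ ≤ _ := by linarith
    rw [Real.norm_eq_abs, abs_div, abs_mul, abs_of_nonneg (mul_nonneg hlamn.le hd0),
      abs_of_nonneg (Real.rpow_nonneg hn'.le _), rpow_three_halves hn'.le,
      div_le_iff₀ (by positivity)]
    calc _ ≤ (n : ℝ) ^ 2 * (lam n * (1 + 2 * ζ * a ^ 2)) :=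
          mul_le_mul (hD.trans hcardle) (mul_le_mul_of_nonneg_left hd1 hlamn.le)
            (mul_nonneg hlamn.le hd0) (by positivity)
      _ = (Real.sqrt n * lam n) * (1 + 2 * ζ * a ^ 2) * (n * Real.sqrt n) := by
          rw [sq]
          nth_rewrite 2 [← hsq]
          ring
      _ ≤ _ := by gcongr
  · refine Eventually.of_forall fun t ht => ?_
    obtain ⟨hg0, hg1⟩ := hcurve t ht
    rw [Set.uIoc_of_le zero_le_one] at ht
    have hfix : a * t * Real.exp (ζ * (a * t) ^ 2) = c * curve ζ a t := by
      rw [curve, ← hac, show ζ * (a * t) ^ 2 = ζ * a ^ 2 + ζ * a ^ 2 * (t ^ 2 - 1) by ring,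
        Real.exp_add]
      ring
    have hct : 2 * ζ * (c * curve ζ a t) ^ 2 < 1 := by
      refine lt_of_le_of_lt ?_ hζc
      have : c * curve ζ a t ≤ c := mul_le_of_le_one_right hc hg1
      gcongr
    have hlct : Tendsto (fun n : ℕ => Real.sqrt n * (lam n * curve ζ a t)) atTop
        (𝓝 (c * curve ζ a t)) := by
      simpa [mul_assoc] using hlc.mul_const (curve ζ a t)
    have key := (tendsto_partitionDeriv_div hT hU hζ hζ1 (fun n => mul_pos (hlam n) hg0) hlct
      (mul_nonneg ha ht.1.le) hfix hct).mul_const (curveDeriv ζ a t / curve ζ a t)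
    have hval : a * t / 2 * (curveDeriv ζ a t / curve ζ a t) = a / 2 + ζ * a ^ 3 * t ^ 2 := by
      have := ht.1.ne'
      have := (Real.exp_pos (ζ * a ^ 2 * (t ^ 2 - 1))).ne'
      rw [curve, curveDeriv]
      field_simp
    rw [hval] at key
    refine key.congr fun n => ?_
    have := hg0.ne'
    field_simp

end Integration

lemma two_mul_zeta_lt {W : ℝ → ℝ} (hW : IsLambertW W) {c η ζ : ℝ} (hc : 0 < c)
    (hcbar : LtCbar W c η) (hζ : 0 < ζ) (hζ1 : ζ ≤ 1) (hζeq : zetaLHS W c ζ = η) :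
    2 * ζ * c ^ 2 < 2 / Real.exp 1 := by
  have hdiv : ∀ x, 0 < x → 0 ≤ W x ∧ W x / x = Real.exp (-W x) := by
    intro x hx
    obtain ⟨h0, h1, -⟩ := hW x hx.le
    refine ⟨h0, ?_⟩
    rw [Real.exp_neg, div_eq_iff hx.ne', inv_mul_eq_div, eq_div_iff (Real.exp_pos _).ne', h1]
  have he : 0 < Real.exp 1 := Real.exp_pos 1
  have hx : 0 < 2 * ζ * c ^ 2 := by positivity
  have hy : 0 < 2 / Real.exp 1 := by positivity
  by_contra! hxy
  have hWle : W (2 / Real.exp 1) ≤ W (2 * ζ * c ^ 2) := by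
    by_contra! hlt
    have h1 := (hW _ hx.le).2.1
    have h2 := (hW _ hy.le).2.1
    have h3 : W (2 * ζ * c ^ 2) * Real.exp (W (2 * ζ * c ^ 2)) <
        W (2 / Real.exp 1) * Real.exp (W (2 / Real.exp 1)) :=
      mul_lt_mul'' hlt (Real.exp_lt_exp.2 hlt) (hdiv _ hx).1 (Real.exp_pos _).le
    linarith
  have hstar : 0 < etaStar W := by
    rw [etaStar, (hdiv _ hy).2]
    exact Real.rpow_pos_of_pos (Real.exp_pos _) _
  have hη : η ≤ (1 - ζ) * etaStar W := by
    rw [← hζeq, zetaLHS, if_neg hζ.ne', etaStar, (hdiv _ hx).2, (hdiv _ hy).2]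
    refine mul_le_mul_of_nonneg_left ?_ (by linarith)
    exact Real.rpow_le_rpow (Real.exp_pos _).le (Real.exp_le_exp.2 (by linarith)) (by norm_num)
  have hlt : η < etaStar W := hη.trans_lt (mul_lt_of_lt_one_left hstar (by linarith))
  have hζle : ζ ≤ 1 - η / etaStar W := by
    have : η / etaStar W ≤ 1 - ζ := (div_le_iff₀ hstar).2 hη
    linarith
  have hpos : 0 < Real.exp 1 * (1 - η / etaStar W) := mul_pos he (hζ.trans_le hζle)
  have hc1 := hcbar hlt
  rw [lt_div_iff₀ (Real.sqrt_pos.2 hpos)] at hc1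
  have hc2 : c ^ 2 * (Real.exp 1 * (1 - η / etaStar W)) < 1 := by
    rw [← Real.sq_sqrt hpos.le, ← mul_pow]
    exact pow_lt_one₀ (by positivity) hc1 two_ne_zero
  rw [div_le_iff₀ he] at hxy
  have : c ^ 2 * (Real.exp 1 * ζ) ≤ c ^ 2 * (Real.exp 1 * (1 - η / etaStar W)) := by gcongr
  linarith

end Hyper

/-- **Lemma (asymptotics of the log partition function `Z(λ,ζ)`).** -/
theorem log_partition_function_asymptotics
    (W : ℝ → ℝ) (hW : IsLambertW W)
    (c η : ℝ) (hc : 0 < c) (hη : η ∈ Set.Ico (0 : ℝ) 1) (hcbar : LtCbar W c η)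
    (zeta : ℝ) (hzeta : zeta ∈ Set.Icc (0 : ℝ) 1) (hzetaEq : zetaLHS W c zeta = η)
    (lam : ℕ → ℝ) (hlam : ∀ n, 0 < lam n)
    (hlc : Tendsto (fun n : ℕ => Real.sqrt n * lam n) atTop (nhds c)) :
    Tendsto (fun n : ℕ => Real.log (Zfun n (lam n) zeta) / (n : ℝ) ^ ((3 : ℝ) / 2))
      atTop
      (nhds ((W (2 * zeta * c ^ 2) ^ ((3 : ℝ) / 2) + 3 * W (2 * zeta * c ^ 2) ^ ((1 : ℝ) / 2)) /
        (6 * Real.sqrt (2 * zeta)))) := by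
  have hζ : 0 < zeta := by
    refine hzeta.1.lt_of_ne fun h => ?_
    rw [← hzetaEq, zetaLHS, if_pos h.symm, ← h] at hη
    simp at hη
  obtain ⟨hw0, hw, -⟩ := hW (2 * zeta * c ^ 2) (by positivity)
  have hlt := Hyper.two_mul_zeta_lt hW hc hcbar hζ hzeta.2 hzetaEq
  have hlt1 : 2 * zeta * c ^ 2 < 1 := by
    refine hlt.trans ((div_lt_one (Real.exp_pos 1)).2 ?_)
    linarith [Real.exp_one_gt_d9]
  set w := W (2 * zeta * c ^ 2)
  set a := Real.sqrt (w / (2 * zeta)) with ha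
  have ha0 : 0 ≤ a := Real.sqrt_nonneg _
  have hwa : w = 2 * zeta * a ^ 2 := by
    rw [ha, Real.sq_sqrt (by positivity)]
    field_simp
  have hac : a * Real.exp (zeta * a ^ 2) = c := by
    rw [← sq_eq_sq₀ (by positivity) hc.le, mul_pow, ← Real.exp_nat_mul]
    have h1 : ((2 : ℕ) : ℝ) * (zeta * a ^ 2) = w := by rw [hwa]; push_cast; ring
    rw [h1]
    have h2 : 2 * zeta * (a ^ 2 * Real.exp w) = 2 * zeta * c ^ 2 := by
      rw [← hw, ← mul_assoc, ← hwa]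
    exact mul_left_cancel₀ (by positivity) h2
  have hlim : (w ^ ((3 : ℝ) / 2) + 3 * w ^ ((1 : ℝ) / 2)) / (6 * Real.sqrt (2 * zeta)) =
      a / 2 + zeta * a ^ 3 / 3 := by
    have hs : 0 < Real.sqrt (2 * zeta) := Real.sqrt_pos.2 (by positivity)
    have hsw : Real.sqrt w = Real.sqrt (2 * zeta) * a := by
      rw [hwa, Real.sqrt_mul (by positivity), Real.sqrt_sq ha0]
    rw [Hyper.rpow_three_halves hw0, ← Real.sqrt_eq_rpow, hsw, div_eq_iff (by positivity), hwa]
    ring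
  rw [hlim]
  simp_rw [Hyper.Zfun_eq_partition]
  exact Hyper.tendsto_log_partition
    (fun n => by simpa using Hyper.isLinearSystem_triangles (Fin n))
    (fun n => by simpa using Hyper.card_pairsIn_univ (Fin n)) hζ.le hzeta.2 hlam hlc ha0 hac hlt1
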